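/- arXiv:1207.5321 — 8 statements merged into one kernel-verified Lean document; each statement's English description precedes it below -/
import Mathlib

section
/- For every n ≥ 3, every cancellation-free linear circuit computing the matrix A_n has at least 2n − 3 gates. -/
/-- A linear circuit over `F_2` with `n` inputs, given as a straight-line program.
Vertices `0, …, n-1` are the inputs `x_1, …, x_n`; vertex `n + g` is gate `g`.
Each gate has in-degree two: its two children `left g` and `right g` are earlier
vertices, and the gate computes the XOR of its children. -/
structure LinCircuit (n : ℕ) where
  gates : ℕ
  left : Fin gates → ℕ
  right : Fin gates → ℕ
  left_lt : ∀ g, left g < n + g.val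
  right_lt : ∀ g, right g < n + g.val

namespace LinCircuit

variable {n : ℕ}

/-- The value vector `κ(v) ∈ F_2^n` of the vertex `v`: for an input `x_i` it is
the `i`-th standard unit vector, and for a gate it is the sum of the value
vectors of its two children. -/
def val (C : LinCircuit n) (v : ℕ) : Fin n → ZMod 2 :=
  if _h1 : v < n then fun j => if (j : ℕ) = v then 1 else 0
  else if h2 : v - n < C.gates then
    C.val (C.left ⟨v - n, h2⟩) + C.val (C.right ⟨v - n, h2⟩)
  else 0
termination_by v
decreasing_by
  · have := C.left_lt ⟨v - n, h2⟩; simp only [Fin.val_mk] at this; omega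
  · have := C.right_lt ⟨v - n, h2⟩; simp only [Fin.val_mk] at this; omega

/-- `C` computes the `m × n` matrix `A` if there are `m` designated output
vertices whose value vectors are exactly the rows of `A`. -/
def Computes {m : ℕ} (C : LinCircuit n) (A : Matrix (Fin m) (Fin n) (ZMod 2)) : Prop :=
  ∃ out : Fin m → ℕ, (∀ o, out o < n + C.gates) ∧ ∀ o j, C.val (out o) j = A o j

/-- `Edge C w u`: there is a wire from vertex `w` to vertex `u`,
i.e. `u` is a gate having `w` as one of its two children. -/
def Edge (C : LinCircuit n) (w u : ℕ) : Prop :=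
  ∃ g : Fin C.gates, u = n + g.val ∧ (C.left g = w ∨ C.right g = w)

/-- A circuit is cancellation-free if along every directed path the value
vectors only grow in the coordinatewise partial order. -/
def CancellationFree (C : LinCircuit n) : Prop :=
  ∀ w u : ℕ, Relation.TransGen C.Edge w u → ∀ i : Fin n, C.val w i = 1 → C.val u i = 1

end LinCircuit

/-- The matrix `A_n`: the first row is `(0,1,1,…,1)` and, for `2 ≤ i ≤ n`, the
`i`-th row has `1` in columns `1,…,i` and `0` elsewhere (the informal statement
indexes rows and columns from `1`; here `Fin n` is indexed from `0`). -/
def Amat (n : ℕ) : Matrix (Fin n) (Fin n) (ZMod 2) :=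
  Matrix.of fun i j =>
    if (i : ℕ) = 0 then (if (j : ℕ) = 0 then 0 else 1)
    else if (j : ℕ) ≤ (i : ℕ) then 1 else 0

theorem LinCircuit.val_input {n : ℕ} (C : LinCircuit n) (v : ℕ) (h : v < n) (j : Fin n) :
    C.val v j = if (j : ℕ) = v then 1 else 0 := by
  rw [LinCircuit.val]; simp [h]

theorem LinCircuit.val_gate {n : ℕ} (C : LinCircuit n) (v : ℕ) (h : ¬ v < n)
    (h2 : v - n < C.gates) (j : Fin n) :
    C.val v j = C.val (C.left ⟨v - n, h2⟩) j + C.val (C.right ⟨v - n, h2⟩) j := by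
  rw [LinCircuit.val]; simp [h, h2]

theorem LinCircuit.val_out {n : ℕ} (C : LinCircuit n) (v : ℕ) (h : ¬ v < n)
    (h2 : ¬ v - n < C.gates) (j : Fin n) : C.val v j = 0 := by
  rw [LinCircuit.val]; simp [h, h2]

theorem zmod2_cases (a : ZMod 2) : a = 0 ∨ a = 1 := by
  revert a; decide

theorem LinCircuit.frontier {n : ℕ} (C : LinCircuit n) (hcf : C.CancellationFree) (z : Fin n)
    (b : ℕ) : ∀ (F : Finset ℕ) (S : Finset (Fin n)), (∀ v ∈ F, v < b) →
      (∀ v ∈ F, C.val v z = 0) → (∀ j ∈ S, ∃ v ∈ F, C.val v j ≠ 0) →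
      S.card ≤ F.card +
        ((Finset.range b).filter (fun v => n ≤ v ∧ v < n + C.gates ∧ C.val v z = 0)).card := by
  induction b with
  | zero =>
    intro F S hF _ hS
    have : S = ∅ := by
      refine Finset.eq_empty_of_forall_notMem fun j hj => ?_
      obtain ⟨v, hv, _⟩ := hS j hj
      exact absurd (hF v hv) (by omega)
    simp [this]
  | succ b ih =>
    intro F S hF hz hS
    have hmono : ((Finset.range b).filter
        (fun v => n ≤ v ∧ v < n + C.gates ∧ C.val v z = 0)).card ≤ ((Finset.range (b+1)).filter
        (fun v => n ≤ v ∧ v < n + C.gates ∧ C.val v z = 0)).card := by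
      apply Finset.card_le_card
      apply Finset.filter_subset_filter
      intro x; simp; omega
    by_cases hb : b ∈ F
    · have hFc : (F.erase b).card + 1 = F.card := Finset.card_erase_add_one hb
      have hlt : ∀ v ∈ F.erase b, v < b := by
        intro v hv
        have h1 := hF v (Finset.mem_of_mem_erase hv)
        have h2 := Finset.ne_of_mem_erase hv
        omega
      have hz' : ∀ v ∈ F.erase b, C.val v z = 0 := fun v hv => hz v (Finset.mem_of_mem_erase hv)
      by_cases h1 : b < n
      · have := ih (F.erase b) (S.erase ⟨b, h1⟩) hlt hz' (by
          intro j hj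
          obtain ⟨v, hv, hvj⟩ := hS j (Finset.mem_of_mem_erase hj)
          refine ⟨v, Finset.mem_erase.2 ⟨?_, hv⟩, hvj⟩
          rintro rfl
          rw [C.val_input v h1] at hvj
          apply Finset.ne_of_mem_erase hj
          ext
          by_contra hne
          simp [hne] at hvj)
        have h3 : S.card - 1 ≤ (S.erase ⟨b, h1⟩).card := Finset.pred_card_le_card_erase
        omega
      · by_cases h2 : b - n < C.gates
        · have hl := C.left_lt ⟨b - n, h2⟩
          have hr := C.right_lt ⟨b - n, h2⟩
          have hv := C.val_gate b h1 h2
          have el : C.val (C.left ⟨b - n, h2⟩) z = 0 := by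
            refine (zmod2_cases _).resolve_right fun h => ?_
            have := hcf (C.left ⟨b - n, h2⟩) b
              (Relation.TransGen.single ⟨⟨b - n, h2⟩, by simp; omega, Or.inl rfl⟩) z h
            rw [hz b hb] at this
            exact absurd this (by decide)
          have er : C.val (C.right ⟨b - n, h2⟩) z = 0 := by
            refine (zmod2_cases _).resolve_right fun h => ?_
            have := hcf (C.right ⟨b - n, h2⟩) b
              (Relation.TransGen.single ⟨⟨b - n, h2⟩, by simp; omega, Or.inr rfl⟩) z h
            rw [hz b hb] at this
            exact absurd this (by decide)
          generalize C.left ⟨b - n, h2⟩ = l at *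
          generalize C.right ⟨b - n, h2⟩ = r at *
          simp only at hl hr
          have := ih (insert l (insert r (F.erase b))) S (by
              intro v hv
              simp only [Finset.mem_insert] at hv
              rcases hv with rfl | rfl | hv
              · omega
              · omega
              · exact hlt v hv) (by
              intro v hv
              simp only [Finset.mem_insert] at hv
              rcases hv with rfl | rfl | hv
              · exact el
              · exact er
              · exact hz' v hv) (by
              intro j hj
              obtain ⟨v, hvF, hvj⟩ := hS j hj
              by_cases hvb : v = b
              · subst hvb
                by_cases h0 : C.val l j = 0
                · refine ⟨r, by simp, fun h0' => hvj ?_⟩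
                  rw [hv, h0, h0']; rfl
                · exact ⟨l, by simp, h0⟩
              · exact ⟨v, by simp [hvb, hvF], hvj⟩)
          have c1 := Finset.card_insert_le l (insert r (F.erase b))
          have c2 := Finset.card_insert_le r (F.erase b)
          rw [Finset.range_add_one, Finset.filter_insert, if_pos ⟨by omega, by omega, hz b hb⟩,
            Finset.card_insert_of_notMem (by simp)]
          omega
        · have := ih (F.erase b) S hlt hz' (by
            intro j hj
            obtain ⟨v, hv, hvj⟩ := hS j hj
            refine ⟨v, Finset.mem_erase.2 ⟨?_, hv⟩, hvj⟩
            rintro rfl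
            exact hvj (C.val_out v h1 h2 j))
          omega
    · have := ih F S (by
        intro v hv
        have h1 := hF v hv
        have h2 : v ≠ b := fun h => hb (h ▸ hv)
        omega) hz hS
      omega

/-- For every `n ≥ 3`, every cancellation-free linear circuit
computing the matrix `A_n` has at least `2n − 3` gates. -/
theorem cancellationFree_Amat_lower_bound (n : ℕ) (hn : 3 ≤ n)
    (C : LinCircuit n) (hcf : C.CancellationFree) (hA : C.Computes (Amat n)) :
    2 * n - 3 ≤ C.gates := by
  obtain ⟨out, hout, hval⟩ := hA
  let z : Fin n := ⟨0, by omega⟩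
  have key := C.frontier hcf z (n + C.gates) {out z} (Finset.univ.erase z)
    (by simpa using hout z) (by simp [hval, Amat, z]) (by
      intro j hj
      refine ⟨out z, by simp, ?_⟩
      have hj0 : (j : ℕ) ≠ 0 := fun h => Finset.ne_of_mem_erase hj (Fin.ext h)
      rw [hval]
      simp [Amat, z, hj0])
  rw [Finset.card_erase_of_mem (Finset.mem_univ _), Finset.card_univ, Fintype.card_fin,
    Finset.card_singleton] at key
  have key2 : n - 1 ≤ ((Finset.range (n + C.gates)).filter
      (fun v => n ≤ v ∧ C.val v z = 1)).card := by
    have hc : (Finset.univ.erase z).card = n - 1 := by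
      rw [Finset.card_erase_of_mem (Finset.mem_univ _), Finset.card_univ, Fintype.card_fin]
    rw [← hc]
    apply Finset.card_le_card_of_injOn out
    · intro i hi
      have hi0 : (i : ℕ) ≠ 0 := fun h => Finset.ne_of_mem_erase hi (Fin.ext h)
      have e0 : C.val (out i) z = 1 := by rw [hval]; simp [Amat, z, hi0]; exact Nat.zero_le _
      have e1 : C.val (out i) ⟨1, by omega⟩ = 1 := by
        rw [hval]; simp [Amat, hi0]; exact Nat.one_le_iff_ne_zero.2 hi0
      simp only [Finset.coe_filter, Finset.mem_range, Set.mem_ofPred_eq]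
      refine ⟨hout i, ?_, e0⟩
      by_contra hlt
      rw [C.val_input _ (by omega)] at e0 e1
      by_cases h0 : (0 : ℕ) = out i
      · simp [← h0] at e1
      · simp [z, h0] at e0
    · intro i hi k hk hik
      have hi0 : (i : ℕ) ≠ 0 := fun h => Finset.ne_of_mem_erase hi (Fin.ext h)
      have hk0 : (k : ℕ) ≠ 0 := fun h => Finset.ne_of_mem_erase hk (Fin.ext h)
      have a1 := hval i i
      have a2 := hval k i
      have a3 := hval i k
      have a4 := hval k k
      rw [hik] at a1 a3
      rw [a2] at a1
      rw [a4] at a3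
      simp [Amat, hi0, hk0] at a1 a3
      exact le_antisymm a1 a3
  have hdisj : Disjoint ((Finset.range (n + C.gates)).filter
      (fun v => n ≤ v ∧ v < n + C.gates ∧ C.val v z = 0))
      ((Finset.range (n + C.gates)).filter (fun v => n ≤ v ∧ C.val v z = 1)) := by
    rw [Finset.disjoint_left]
    intro v h1 h2
    have h1 := (Finset.mem_filter.1 h1).2.2.2
    have h2 := (Finset.mem_filter.1 h2).2.2
    rw [h1] at h2
    exact absurd h2 (by decide)
  have hsub := Finset.card_le_card (s := ((Finset.range (n + C.gates)).filter
      (fun v => n ≤ v ∧ v < n + C.gates ∧ C.val v z = 0)) ∪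
      ((Finset.range (n + C.gates)).filter (fun v => n ≤ v ∧ C.val v z = 1)))
      (t := Finset.Ico n (n + C.gates)) (by
    intro v hv
    simp only [Finset.mem_union, Finset.mem_filter, Finset.mem_range] at hv
    rw [Finset.mem_Ico]
    rcases hv with hv | hv
    · exact ⟨hv.2.1, hv.1⟩
    · exact ⟨hv.2.1, hv.1⟩)
  rw [Finset.card_union_of_disjoint hdisj, Nat.card_Ico] at hsub
  omega
end

section
/- For every n ≥ 2, the matrix A_n can be computed by a linear circuit (cancellation allowed) with exactly n gates. -/
/-- For every `n ≥ 2`, the matrix `A_n` can be computed by a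
linear circuit (cancellation allowed) with exactly `n` gates. -/
theorem Amat_upper_bound (n : ℕ) (hn : 2 ≤ n) :
    ∃ C : LinCircuit n, C.Computes (Amat n) ∧ C.gates = n := by
  let C : LinCircuit n :=
    { gates := n
      left := fun g => if g.val = 0 then 0 else n + g.val - 1
      right := fun g => if g.val + 1 < n then g.val + 1 else 0
      left_lt := by intro g; split_ifs <;> omega
      right_lt := by intro g; split_ifs <;> omega }
  have hin : ∀ v, v < n → ∀ j : Fin n, C.val v j = if (j : ℕ) = v then 1 else 0 := by
    intro v hv j
    rw [LinCircuit.val, dif_pos hv]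
  have hg : ∀ g, g < n → ∀ j : Fin n, C.val (n + g) j =
      C.val (if g = 0 then 0 else n + g - 1) j + C.val (if g + 1 < n then g + 1 else 0) j := by
    intro g hgn j
    have h1 : ¬ (n + g < n) := by omega
    have h2 : n + g - n < C.gates := by
      show n + g - n < n
      omega
    rw [LinCircuit.val, dif_neg h1, dif_pos h2]
    have h3 : n + g - n = g := by omega
    simp only [C, Pi.add_apply, h3]
  have hpre : ∀ g, g + 1 < n → ∀ j : Fin n, C.val (n + g) j =
      if (j : ℕ) ≤ g + 1 then 1 else 0 := by
    intro g
    induction g with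
    | zero =>
      intro h j
      rw [hg 0 (by omega) j, if_pos rfl, if_pos h, hin _ (by omega), hin _ (by omega)]
      split_ifs <;> first | omega | simp
    | succ k ih =>
      intro h j
      rw [hg (k + 1) (by omega) j, if_neg (by omega), if_pos h, hin _ h,
        show n + (k + 1) - 1 = n + k by omega, ih (by omega) j]
      split_ifs <;> first | omega | simp
  refine ⟨C, ⟨fun o => if o.val = 0 then n + (n - 1) else n + (o.val - 1), ?_, ?_⟩, rfl⟩
  · intro o
    show _ < n + n
    have := o.isLt
    dsimp only
    split_ifs <;> omega
  · intro o j
    have ho := o.isLt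
    have hj := j.isLt
    simp only [Amat, Matrix.of_apply]
    by_cases h0 : o.val = 0
    · rw [if_pos h0, if_pos h0, hg (n - 1) (by omega) j, if_neg (by omega), if_neg (by omega),
        show n + (n - 1) - 1 = n + (n - 2) by omega, hpre (n - 2) (by omega) j,
        hin 0 (by omega) j, if_pos (by omega)]
      by_cases hj0 : j.val = 0
      · rw [if_pos hj0, if_pos hj0]; decide
      · rw [if_neg hj0, if_neg hj0]; decide
    · rw [if_neg h0, if_neg h0, hpre (o.val - 1) (by omega) j,
        show o.val - 1 + 1 = o.val by omega]
end

section
/- For every n ≥ 3, the ratio of the minimum size of a cancellation-free linear circuit computing A_n to the minimum size of a linear circuit computing A_n is at least (2n − 3)/n; consequently this ratio tends to 2 from below, so the cancellation ratio ρ(n) satisfies ρ(n) ≥ 2 − o(1). -/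
/-- The minimum size of a cancellation-free linear circuit computing `A`. -/
noncomputable def cfMin (n : ℕ) (A : Matrix (Fin n) (Fin n) (ZMod 2)) : ℕ :=
  sInf {s | ∃ C : LinCircuit n, C.CancellationFree ∧ C.Computes A ∧ C.gates = s}

/-- The minimum size of a linear circuit (cancellation allowed) computing `A`. -/
noncomputable def linMin (n : ℕ) (A : Matrix (Fin n) (Fin n) (ZMod 2)) : ℕ :=
  sInf {s | ∃ C : LinCircuit n, C.Computes A ∧ C.gates = s}

/-- The cancellation ratio `ρ(n)`: the maximum, over `n × n` matrices `M` over
`F_2`, of the ratio of the minimum cancellation-free circuit size for `M` to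
the minimum linear circuit size for `M`. -/
noncomputable def cancellationRatio (n : ℕ) : ℝ :=
  sSup {r : ℝ | ∃ M : Matrix (Fin n) (Fin n) (ZMod 2),
    r = (cfMin n M : ℝ) / (linMin n M : ℝ)}

namespace LinCircuit

variable {n : ℕ}

theorem val_input_s2 (C : LinCircuit n) (v : ℕ) (h : v < n) (j : Fin n) :
    C.val v j = if (j : ℕ) = v then 1 else 0 := by
  rw [val, dif_pos h]

theorem val_gate_s2 (C : LinCircuit n) (g : ℕ) (h : g < C.gates) (j : Fin n) :
    C.val (n + g) j = C.val (C.left ⟨g, h⟩) j + C.val (C.right ⟨g, h⟩) j := by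
  have e : n + g - n = g := by omega
  conv_lhs => rw [val, dif_neg (by omega : ¬ n + g < n), dif_pos (by omega)]
  simp [e]

theorem cf_of_step (C : LinCircuit n)
    (h : ∀ w u, C.Edge w u → ∀ i : Fin n, C.val w i = 1 → C.val u i = 1) :
    C.CancellationFree := by
  intro w u p
  induction p with
  | single e => exact h _ _ e
  | tail _ e ih => exact fun i hi => h _ _ e i (ih i hi)

theorem zmod_cases (a : ZMod 2) : a = 0 ∨ a = 1 := by
  revert a; decide

open Classical in
theorem support_bound (C : LinCircuit n) (hC : C.CancellationFree) (z : Fin n) (t : ℕ) :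
    t ≤ C.gates → ∀ F : Finset ℕ, (∀ v ∈ F, v < n + t ∧ C.val v z = 0) →
    (Finset.univ.filter fun j : Fin n => ∃ v ∈ F, C.val v j ≠ 0).card ≤
      F.card + ((Finset.range t).filter fun g => C.val (n + g) z = 0).card := by
  induction t with
  | zero =>
    intro _ F hF
    simp only [Finset.range_zero, Finset.filter_empty, Finset.card_empty, add_zero]
    apply Finset.card_le_card_of_injOn (fun j : Fin n => (j : ℕ))
    · intro j hj
      simp only [Finset.coe_filter, Finset.mem_univ, true_and, Set.mem_ofPred_eq] at hj
      obtain ⟨v, hv, h⟩ := hj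
      rw [C.val_input_s2 v (by simpa using (hF v hv).1)] at h
      have : (j : ℕ) = v := by
        by_contra hne
        simp [hne] at h
      simpa [this] using hv
    · intro a _ b _ hab
      exact Fin.ext hab
  | succ t ih =>
    intro ht F hF
    rw [Finset.range_add_one, Finset.filter_insert]
    by_cases hm : n + t ∈ F
    · have hz := (hF _ hm).2
      have hlt : t < C.gates := by omega
      set l := C.left ⟨t, hlt⟩ with hl
      set r := C.right ⟨t, hlt⟩ with hr
      have l1 : l < n + t := C.left_lt ⟨t, hlt⟩
      have r1 : r < n + t := C.right_lt ⟨t, hlt⟩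
      have el : C.val l z = 0 := by
        rcases zmod_cases (C.val l z) with h | h
        · exact h
        · have := hC l (n + t) (.single ⟨⟨t, hlt⟩, rfl, Or.inl rfl⟩) z h
          rw [hz] at this; exact absurd this (by decide)
      have er : C.val r z = 0 := by
        rcases zmod_cases (C.val r z) with h | h
        · exact h
        · have := hC r (n + t) (.single ⟨⟨t, hlt⟩, rfl, Or.inr rfl⟩) z h
          rw [hz] at this; exact absurd this (by decide)
      have key := ih (by omega) (insert l (insert r (F.erase (n + t)))) (by
        intro v hv
        simp only [Finset.mem_insert, Finset.mem_erase] at hv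
        rcases hv with rfl | rfl | ⟨h1, h2⟩
        · exact ⟨l1, el⟩
        · exact ⟨r1, er⟩
        · exact ⟨by have := (hF v h2).1; omega, (hF v h2).2⟩)
      have hsub : (Finset.univ.filter fun j : Fin n => ∃ v ∈ F, C.val v j ≠ 0) ⊆
          (Finset.univ.filter fun j : Fin n =>
            ∃ v ∈ insert l (insert r (F.erase (n + t))), C.val v j ≠ 0) := by
        intro j hj
        simp only [Finset.mem_filter, Finset.mem_univ, true_and] at hj ⊢
        obtain ⟨v, hv, h⟩ := hj
        by_cases hvt : v = n + t
        · subst hvt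
          rw [C.val_gate_s2 t hlt] at h
          by_cases h0 : C.val l j = 0
          · refine ⟨r, by simp, fun h1 => h ?_⟩
            rw [← hl, ← hr, h0, h1, add_zero]
          · exact ⟨l, by simp, h0⟩
        · exact ⟨v, by simp [hv, hvt], h⟩
      have h1 := Finset.card_le_card hsub
      have h2 := Finset.card_insert_le l (insert r (F.erase (n + t)))
      have h3 := Finset.card_insert_le r (F.erase (n + t))
      have h4 := Finset.card_erase_add_one hm
      rw [if_pos hz, Finset.card_insert_of_notMem (by simp)]
      omega
    · have key := ih (by omega) F (by
        intro v hv
        refine ⟨?_, (hF v hv).2⟩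
        have := (hF v hv).1
        have : v ≠ n + t := fun h => hm (h ▸ hv)
        omega)
      refine key.trans (Nat.add_le_add_left (Finset.card_le_card ?_) _)
      split_ifs
      · exact Finset.subset_insert _ _
      · exact subset_rfl

open Classical in
theorem cf_lower (hn : 3 ≤ n) (C : LinCircuit n) (hC : C.CancellationFree)
    (hA : C.Computes (Amat n)) : 2 * n ≤ C.gates + 3 := by
  obtain ⟨out, hlt, hout⟩ := hA
  let z : Fin n := ⟨0, by omega⟩
  have hsplit := Finset.card_filter_add_card_filter_not
    (s := Finset.range C.gates) (fun g => C.val (n + g) z = 0)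
  rw [Finset.card_range] at hsplit
  have b1 := C.support_bound hC z C.gates le_rfl {out z} (by
    intro v hv
    rw [Finset.mem_singleton] at hv
    subst hv
    exact ⟨hlt z, by rw [hout]; simp [Amat, z]⟩)
  have b2 : n - 1 ≤ (Finset.univ.filter fun j : Fin n =>
      ∃ v ∈ ({out z} : Finset ℕ), C.val v j ≠ 0).card := by
    have : (Finset.univ.erase z : Finset (Fin n)).card = n - 1 := by
      rw [Finset.card_erase_of_mem (Finset.mem_univ _)]; simp
    rw [← this]
    apply Finset.card_le_card
    intro j hj
    have hj0 : (j : ℕ) ≠ 0 := by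
      intro h
      exact (Finset.mem_erase.1 hj).1 (Fin.ext h)
    simp [hout, Amat, z, hj0]
  have b3 : n - 1 ≤ ((Finset.range C.gates).filter fun g => ¬ C.val (n + g) z = 0).card := by
    have : (Finset.univ.erase z : Finset (Fin n)).card = n - 1 := by
      rw [Finset.card_erase_of_mem (Finset.mem_univ _)]; simp
    rw [← this]
    have hne : ∀ o : Fin n, o ≠ z → (o : ℕ) ≠ 0 := fun o h h' => h (Fin.ext h')
    have hge : ∀ o : Fin n, o ≠ z → n ≤ out o := by
      intro o ho
      by_contra hcon
      push Not at hcon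
      have ho0 := hne o ho
      have h0 := hout o z
      have h1 := hout o ⟨1, by omega⟩
      rw [C.val_input_s2 _ hcon] at h0 h1
      have : 1 ≤ (o : ℕ) := by omega
      simp only [Amat, z, Matrix.of_apply, if_neg ho0, if_pos this, if_pos (Nat.zero_le _)] at h0 h1
      simp at h0 h1
      omega
    apply Finset.card_le_card_of_injOn (fun o : Fin n => out o - n)
    · intro o ho
      have ho' : o ≠ z := by simpa using ho
      have := hge o ho'
      have h2 := hlt o
      have e : n + (out o - n) = out o := by omega
      simp only [Finset.coe_filter, Finset.mem_range, Set.mem_ofPred_eq, e, hout]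
      refine ⟨by omega, ?_⟩
      simp only [Amat, z, Matrix.of_apply, if_neg (hne o ho'), if_pos (Nat.zero_le _)]
      decide
    · intro a ha b hb hab
      have ha' : a ≠ z := by simpa using ha
      have hb' : b ≠ z := by simpa using hb
      have h1 := hge a ha'
      have h2 := hge b hb'
      have hab' : out a - n = out b - n := hab
      have e : out a = out b := by omega
      have ha0 := hne a ha'
      have hb0 := hne b hb'
      have k1 := hout a a
      have k2 := hout b a
      have k3 := hout a b
      have k4 := hout b b
      rw [e] at k1 k3
      rw [k2] at k1
      rw [k4] at k3
      simp [Amat, ha0, hb0] at k1 k3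
      exact Fin.ext (le_antisymm k1 k3)
  rw [Finset.card_singleton] at b1
  omega

/-- The linear circuit of size `n` for `A_n`. -/
def circ1 (n : ℕ) (hn : 3 ≤ n) : LinCircuit n where
  gates := n
  left g := if g.val = 0 then 0 else n + g.val - 1
  right g := if g.val < n - 1 then g.val + 1 else 0
  left_lt g := by split_ifs <;> omega
  right_lt g := by split_ifs <;> omega

/-- The cancellation-free circuit of size `2n-3` for `A_n`. -/
def circ2 (n : ℕ) (hn : 3 ≤ n) : LinCircuit n where
  gates := 2 * n - 3
  left g := if g.val = 0 then 0 else if g.val = n - 1 then 1 else n + g.val - 1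
  right g := if g.val < n - 1 then g.val + 1 else g.val - (n - 1) + 2
  left_lt g := by split_ifs <;> omega
  right_lt g := by split_ifs <;> omega

theorem circ1_val (hn : 3 ≤ n) (g : ℕ) (hg : g < n - 1) (j : Fin n) :
    (circ1 n hn).val (n + g) j = if (j : ℕ) ≤ g + 1 then 1 else 0 := by
  induction g with
  | zero =>
    rw [val_gate_s2 _ 0 (by simp [circ1]; omega)]
    simp only [circ1, if_true]
    rw [if_pos hg, val_input_s2 _ _ (by omega), val_input_s2 _ _ (by omega)]
    split_ifs <;> first | omega | rfl
  | succ g ih =>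
    rw [val_gate_s2 _ (g + 1) (by simp [circ1]; omega)]
    have e : (circ1 n hn).left ⟨g + 1, by simp [circ1]; omega⟩ = n + g := by simp [circ1]
    have e' : (circ1 n hn).right ⟨g + 1, by simp [circ1]; omega⟩ = g + 2 := by
      simp [circ1, hg]
    rw [e, e', ih (by omega), val_input_s2 _ _ (by omega)]
    split_ifs <;> first | omega | rfl

theorem circ1_computes (hn : 3 ≤ n) : (circ1 n hn).Computes (Amat n) := by
  refine ⟨fun o => if (o : ℕ) = 0 then n + (n - 1) else n + ((o : ℕ) - 1), ?_, ?_⟩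
  · intro o
    have : (circ1 n hn).gates = n := rfl
    beta_reduce
    split_ifs <;> omega
  · intro o j
    by_cases h : (o : ℕ) = 0
    · simp only [h, if_true]
      rw [val_gate_s2 _ (n - 1) (by simp [circ1]; omega)]
      have e : (circ1 n hn).left ⟨n - 1, by simp [circ1]; omega⟩ = n + (n - 2) := by
        simp only [circ1]; split_ifs <;> omega
      have e' : (circ1 n hn).right ⟨n - 1, by simp [circ1]; omega⟩ = 0 := by
        simp [circ1]
      rw [e, e', circ1_val hn _ (by omega), val_input_s2 _ _ (by omega)]
      simp only [Amat, Matrix.of_apply, h, if_true]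
      split_ifs <;> first | omega | rfl
    · simp only [h, if_false]
      rw [circ1_val hn _ (by omega)]
      simp only [Amat, Matrix.of_apply, h, if_false]
      split_ifs <;> first | omega | rfl

theorem circ2_val (hn : 3 ≤ n) (g : ℕ) (hg : g < n - 1) (j : Fin n) :
    (circ2 n hn).val (n + g) j = if (j : ℕ) ≤ g + 1 then 1 else 0 := by
  induction g with
  | zero =>
    rw [val_gate_s2 _ 0 (by simp [circ2]; omega)]
    simp only [circ2, if_true]
    rw [if_pos hg, val_input_s2 _ _ (by omega), val_input_s2 _ _ (by omega)]
    split_ifs <;> first | omega | rfl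
  | succ g ih =>
    rw [val_gate_s2 _ (g + 1) (by simp [circ2]; omega)]
    have e : (circ2 n hn).left ⟨g + 1, by simp [circ2]; omega⟩ = n + g := by
      change (if g + 1 = 0 then 0 else if g + 1 = n - 1 then 1 else n + (g + 1) - 1) = n + g
      rw [if_neg (by omega), if_neg (by omega)]; omega
    have e' : (circ2 n hn).right ⟨g + 1, by simp [circ2]; omega⟩ = g + 2 := by
      simp [circ2, hg]
    rw [e, e', ih (by omega), val_input_s2 _ _ (by omega)]
    split_ifs <;> first | omega | rfl

theorem circ2_val' (hn : 3 ≤ n) (h : ℕ) (hh : h < n - 2) (j : Fin n) :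
    (circ2 n hn).val (n + (n - 1 + h)) j =
      if 1 ≤ (j : ℕ) ∧ (j : ℕ) ≤ h + 2 then 1 else 0 := by
  induction h with
  | zero =>
    rw [val_gate_s2 _ (n - 1 + 0) (by simp [circ2]; omega)]
    have e : (circ2 n hn).left ⟨n - 1 + 0, by simp [circ2]; omega⟩ = 1 := by
      simp only [circ2]; split_ifs <;> omega
    have e' : (circ2 n hn).right ⟨n - 1 + 0, by simp [circ2]; omega⟩ = 2 := by
      simp [circ2]
    rw [e, e', val_input_s2 _ _ (by omega), val_input_s2 _ _ (by omega)]
    split_ifs <;> first | omega | rfl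
  | succ h ih =>
    rw [val_gate_s2 _ (n - 1 + (h + 1)) (by simp [circ2]; omega)]
    have e : (circ2 n hn).left ⟨n - 1 + (h + 1), by simp [circ2]; omega⟩
        = n + (n - 1 + h) := by
      change (if n - 1 + (h + 1) = 0 then 0 else if n - 1 + (h + 1) = n - 1 then 1
        else n + (n - 1 + (h + 1)) - 1) = n + (n - 1 + h)
      rw [if_neg (by omega), if_neg (by omega)]; omega
    have e' : (circ2 n hn).right ⟨n - 1 + (h + 1), by simp [circ2]; omega⟩ = h + 3 := by
      simp only [circ2]; split_ifs <;> omega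
    rw [e, e', ih (by omega), val_input_s2 _ _ (by omega)]
    split_ifs <;> first | omega | rfl

theorem circ2_computes (hn : 3 ≤ n) : (circ2 n hn).Computes (Amat n) := by
  refine ⟨fun o => if (o : ℕ) = 0 then n + (n - 1 + (n - 3)) else n + ((o : ℕ) - 1), ?_, ?_⟩
  · intro o
    have : (circ2 n hn).gates = 2 * n - 3 := rfl
    beta_reduce
    split_ifs <;> omega
  · intro o j
    by_cases h : (o : ℕ) = 0
    · simp only [h, if_true]
      rw [circ2_val' hn _ (by omega)]
      simp only [Amat, Matrix.of_apply, h, if_true]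
      split_ifs <;> first | omega | rfl
    · simp only [h, if_false]
      rw [circ2_val hn _ (by omega)]
      simp only [Amat, Matrix.of_apply, h, if_false]
      split_ifs <;> first | omega | rfl

theorem circ2_cf (hn : 3 ≤ n) : (circ2 n hn).CancellationFree := by
  apply cf_of_step
  rintro w u ⟨⟨g, hg⟩, rfl, h⟩ i hi
  have hg' : g < 2 * n - 3 := hg
  have main : (i : ℕ) = w ∧ w < n ∨ (n ≤ w ∧ (circ2 n hn).val w i = 1) := by
    by_cases hw : w < n
    · left
      rw [val_input_s2 _ _ hw] at hi
      refine ⟨?_, hw⟩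
      by_contra hne
      simp [hne] at hi
    · exact Or.inr ⟨by omega, hi⟩
  by_cases hgn : g < n - 1
  · simp only [circ2_val hn g hgn]
    rw [if_pos]
    rcases h with h | h
    · simp only [circ2] at h
      by_cases g0 : g = 0
      · simp only [g0, if_true] at h
        rcases main with m | m <;> omega
      · rw [if_neg g0, if_neg (by omega)] at h
        rcases main with m | m
        · omega
        · have e : w = n + (g - 1) := by omega
          rw [e, circ2_val hn _ (by omega)] at hi
          by_contra hne
          rw [if_neg (by omega)] at hi
          exact absurd hi (by decide)
    · simp only [circ2] at h
      rw [if_pos hgn] at h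
      rcases main with m | m <;> omega
  · obtain ⟨k, rfl⟩ : ∃ k, g = n - 1 + k := ⟨g - (n - 1), by omega⟩
    simp only [circ2_val' hn k (by omega)]
    rw [if_pos]
    rcases h with h | h
    · simp only [circ2] at h
      rw [if_neg (by omega)] at h
      by_cases g0 : k = 0
      · rw [if_pos (by omega)] at h
        rcases main with m | m <;> omega
      · rw [if_neg (by omega)] at h
        rcases main with m | m
        · omega
        · have e : w = n + (n - 1 + (k - 1)) := by omega
          rw [e, circ2_val' hn _ (by omega)] at hi
          by_contra hne
          rw [if_neg (by omega)] at hi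
          exact absurd hi (by decide)
    · simp only [circ2] at h
      rw [if_neg hgn] at h
      rcases main with m | m <;> omega

theorem gates_pos (hn : 3 ≤ n) (C : LinCircuit n) (hA : C.Computes (Amat n)) :
    0 < C.gates := by
  by_contra hcon
  obtain ⟨out, hlt, hout⟩ := hA
  have hl := hlt ⟨0, by omega⟩
  have h1 := hout ⟨0, by omega⟩ ⟨1, by omega⟩
  have h2 := hout ⟨0, by omega⟩ ⟨2, by omega⟩
  rw [C.val_input_s2 _ (by omega)] at h1 h2
  simp [Amat] at h1 h2
  omega

end LinCircuit

theorem linMin_le {n : ℕ} (hn : 3 ≤ n) : linMin n (Amat n) ≤ n :=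
  Nat.sInf_le ⟨LinCircuit.circ1 n hn, LinCircuit.circ1_computes hn, rfl⟩

theorem linMin_pos {n : ℕ} (hn : 3 ≤ n) : 0 < linMin n (Amat n) := by
  obtain ⟨C, hC, h⟩ := Nat.sInf_mem (s := {s | ∃ C : LinCircuit n, C.Computes (Amat n) ∧
    C.gates = s}) ⟨_, LinCircuit.circ1 n hn, LinCircuit.circ1_computes hn, rfl⟩
  rw [linMin, ← h]
  exact C.gates_pos hn hC

theorem cfMin_ge {n : ℕ} (hn : 3 ≤ n) : 2 * n ≤ cfMin n (Amat n) + 3 := by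
  obtain ⟨C, hC, hA, h⟩ := Nat.sInf_mem (s := {s | ∃ C : LinCircuit n, C.CancellationFree ∧
    C.Computes (Amat n) ∧ C.gates = s})
    ⟨_, LinCircuit.circ2 n hn, LinCircuit.circ2_cf hn, LinCircuit.circ2_computes hn, rfl⟩
  rw [cfMin, ← h]
  exact C.cf_lower hn hC hA

theorem ratio_ge (n : ℕ) (hn : 3 ≤ n) :
    ((2 * n - 3 : ℝ) / n) ≤ (cfMin n (Amat n) : ℝ) / (linMin n (Amat n) : ℝ) := by
  have h1 : (linMin n (Amat n) : ℝ) ≤ n := by exact_mod_cast linMin_le hn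
  have h2 : (0 : ℝ) < linMin n (Amat n) := by exact_mod_cast linMin_pos hn
  have h3 : (2 * n : ℝ) ≤ cfMin n (Amat n) + 3 := by exact_mod_cast cfMin_ge hn
  exact div_le_div₀ (Nat.cast_nonneg _) (by linarith) h2 h1

theorem ratio_tendsto :
    Filter.Tendsto (fun n : ℕ => ((2 * n - 3 : ℝ) / n)) Filter.atTop (nhds 2) := by
  have h : Filter.Tendsto (fun n : ℕ => (2 : ℝ) - 3 / n) Filter.atTop (nhds (2 - 0)) :=
    tendsto_const_nhds.sub (tendsto_const_div_atTop_nhds_zero_nat 3)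
  rw [sub_zero] at h
  refine h.congr' ?_
  filter_upwards [Filter.eventually_gt_atTop 0] with n hn
  have : (n : ℝ) ≠ 0 := by positivity
  field_simp

theorem ratio_le_rho (n : ℕ) :
    (cfMin n (Amat n) : ℝ) / (linMin n (Amat n) : ℝ) ≤ cancellationRatio n := by
  apply le_csSup
  · apply Set.Finite.bddAbove
    have : {r : ℝ | ∃ M : Matrix (Fin n) (Fin n) (ZMod 2),
        r = (cfMin n M : ℝ) / (linMin n M : ℝ)} =
        Set.range (fun M : Matrix (Fin n) (Fin n) (ZMod 2) =>
          (cfMin n M : ℝ) / (linMin n M : ℝ)) := by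
      ext r; simp [eq_comm]
    rw [this]
    exact Set.finite_range _
  · exact ⟨_, rfl⟩

/-- For every `n ≥ 3`, the ratio of the minimum size of a
cancellation-free linear circuit computing `A_n` to the minimum size of a
linear circuit computing `A_n` is at least `(2n − 3)/n`; consequently this
ratio tends to `2` from below, so the cancellation ratio `ρ(n)` satisfies
`ρ(n) ≥ 2 − o(1)`. -/
theorem cancellation_ratio_ge_two_sub_o_one :
    (∀ n : ℕ, 3 ≤ n →
      ((2 * n - 3 : ℝ) / n) ≤ (cfMin n (Amat n) : ℝ) / (linMin n (Amat n) : ℝ)) ∧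
    (Filter.Tendsto (fun n : ℕ => ((2 * n - 3 : ℝ) / n)) Filter.atTop (nhds 2) ∧
      ∀ n : ℕ, 3 ≤ n → ((2 * n - 3 : ℝ) / n) < 2) ∧
    (∀ ε : ℝ, 0 < ε → ∃ N : ℕ, ∀ n : ℕ, N ≤ n → 2 - ε ≤ cancellationRatio n) := by
  refine ⟨ratio_ge, ⟨ratio_tendsto, ?_⟩, ?_⟩
  · intro n hn
    have : (0 : ℝ) < n := by exact_mod_cast (by omega : 0 < n)
    rw [div_lt_iff₀ this]
    linarith
  · intro ε hε
    have h := ratio_tendsto.eventually (lt_mem_nhds (by linarith : 2 - ε < 2))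
    obtain ⟨N, hN⟩ := Filter.eventually_atTop.1 h
    refine ⟨max N 3, fun n hn => ?_⟩
    have h1 := hN n (le_trans (le_max_left _ _) hn)
    have h2 := ratio_ge n (le_trans (le_max_right _ _) hn)
    have h3 := ratio_le_rho n
    linarith
end

section
/- For all positive integers n and M, the number of distinct n×n matrices over F_2 computable by a linear circuit with at most M gates is at most (n+M)^{2M} · (n+M+1)^n / M!. -/
namespace CountAux

/-- the unit vectors -/
def IsUnitV {n : ℕ} (u : Fin n → ZMod 2) : Prop := ∃ i : Fin n, u = Pi.single i 1

/-- value sets of circuits without repeated gate values -/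
inductive Rch {n : ℕ} : Finset (Fin n → ZMod 2) → Prop
  | nil : Rch ∅
  | cons (S : Finset (Fin n → ZMod 2)) (u v : Fin n → ZMod 2) (h : Rch S)
      (hu : IsUnitV u ∨ u ∈ S) (hv : IsUnitV v ∨ v ∈ S) (hn : u + v ∉ S) :
      Rch (insert (u + v) S)

theorem rch_of_circuit {n : ℕ} (C : LinCircuit n) (k : ℕ) (hk : k ≤ C.gates) :
    ∃ S : Finset (Fin n → ZMod 2), Rch S ∧ S.card ≤ k ∧
      ∀ v < n + k, IsUnitV (C.val v) ∨ C.val v ∈ S := by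
  induction k with
  | zero =>
    refine ⟨∅, Rch.nil, by simp, fun v hv => Or.inl ⟨⟨v, by omega⟩, ?_⟩⟩
    rw [LinCircuit.val, dif_pos (by omega)]
    funext j
    simp [Pi.single_apply, Fin.ext_iff]
  | succ k ih =>
    obtain ⟨S, hS, hc, hv⟩ := ih (by omega)
    have hg : k < C.gates := by omega
    have hval : C.val (n + k) = C.val (C.left ⟨k, hg⟩) + C.val (C.right ⟨k, hg⟩) := by
      rw [LinCircuit.val, dif_neg (by omega)]
      simp [hg]
    have hl := hv _ (C.left_lt ⟨k, hg⟩)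
    have hr := hv _ (C.right_lt ⟨k, hg⟩)
    by_cases hm : C.val (n + k) ∈ S
    · refine ⟨S, hS, by omega, fun v hvk => ?_⟩
      rcases Nat.lt_or_ge v (n + k) with h | h
      · exact hv v h
      · obtain rfl : v = n + k := by omega
        exact Or.inr hm
    · refine ⟨insert (C.val (n + k)) S, ?_, ?_, fun v hvk => ?_⟩
      · rw [hval] at hm ⊢
        exact Rch.cons S _ _ hS hl hr hm
      · have := Finset.card_insert_le (C.val (n + k)) S
        omega
      · rcases Nat.lt_or_ge v (n + k) with h | h
        · rcases hv v h with h' | h'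
          · exact Or.inl h'
          · exact Or.inr (Finset.mem_insert_of_mem h')
        · obtain rfl : v = n + k := by omega
          exact Or.inr (Finset.mem_insert_self _ _)

theorem all_of_closed {n : ℕ} (hn : 0 < n) (S : Finset (Fin n → ZMod 2))
    (h : ∀ u v, (IsUnitV u ∨ u ∈ S) → (IsUnitV v ∨ v ∈ S) → u + v ∈ S) : S = Finset.univ := by
  have h2 : ∀ u : Fin n → ZMod 2, u + u = 0 := fun u => by
    funext i; exact CharTwo.add_self_eq_zero _
  have h0 : (0 : Fin n → ZMod 2) ∈ S := by
    have := h _ _ (Or.inl ⟨⟨0, hn⟩, rfl⟩) (Or.inl ⟨⟨0, hn⟩, rfl⟩)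
    rwa [h2] at this
  ext w
  simp only [Finset.mem_univ, iff_true]
  have hs : ∀ T : Finset (Fin n), (∑ i ∈ T, Pi.single i (w i) : Fin n → ZMod 2) ∈ S := by
    intro T
    induction T using Finset.induction_on with
    | empty => simpa using h0
    | insert a T ha ih =>
      rw [Finset.sum_insert ha]
      refine h _ _ ?_ (Or.inr ih)
      have : ∀ x : ZMod 2, x = 0 ∨ x = 1 := by decide
      rcases this (w a) with e | e
      · rw [e, Pi.single_zero]; exact Or.inr h0
      · rw [e]; exact Or.inl ⟨a, rfl⟩
  have := hs Finset.univ
  rwa [Finset.univ_sum_single] at this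

theorem pad {n : ℕ} (hn : 0 < n) (S : Finset (Fin n → ZMod 2)) (hS : Rch S) (d : ℕ)
    (hd : S.card + d ≤ 2 ^ n) : ∃ T, S ⊆ T ∧ Rch T ∧ T.card = S.card + d := by
  induction d with
  | zero => exact ⟨S, subset_rfl, hS, rfl⟩
  | succ d ih =>
    obtain ⟨T, hST, hT, hc⟩ := ih (by omega)
    have hne : T ≠ Finset.univ := by
      rintro rfl
      simp [ZMod.card] at hc
      omega
    have : ¬ ∀ u v, (IsUnitV u ∨ u ∈ T) → (IsUnitV v ∨ v ∈ T) → u + v ∈ T :=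
      fun h => hne (all_of_closed hn T h)
    push Not at this
    obtain ⟨u, v, hu, hv, hm⟩ := this
    refine ⟨insert (u + v) T, hST.trans (Finset.subset_insert _ _), Rch.cons T u v hT hu hv hm, ?_⟩
    rw [Finset.card_insert_of_notMem hm]
    omega

theorem rank {n : ℕ} (S : Finset (Fin n → ZMod 2)) (hS : Rch S) :
    ∃ ρ : (Fin n → ZMod 2) → ℕ, ∀ w ∈ S, ∃ u v, w = u + v ∧
      (IsUnitV u ∨ (u ∈ S ∧ ρ u < ρ w)) ∧ (IsUnitV v ∨ (v ∈ S ∧ ρ v < ρ w)) := by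
  induction hS with
  | nil => exact ⟨fun _ => 0, by simp⟩
  | cons S u v h hu hv hm ih =>
    obtain ⟨ρ, hρ⟩ := ih
    have key : ∀ x ∈ S, Function.update ρ (u + v) (S.sup ρ + 1) x = ρ x := fun x hx => by
      rw [Function.update_of_ne]
      rintro rfl
      exact hm hx
    refine ⟨Function.update ρ (u + v) (S.sup ρ + 1), fun w hw => ?_⟩
    rcases Finset.mem_insert.1 hw with rfl | hw
    · refine ⟨u, v, rfl, hu.imp_right fun hx => ⟨Finset.mem_insert_of_mem hx, ?_⟩,
        hv.imp_right fun hx => ⟨Finset.mem_insert_of_mem hx, ?_⟩⟩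
      all_goals
        rw [key _ hx, Function.update_self]
        exact Nat.lt_succ_of_le (Finset.le_sup hx)
    · obtain ⟨a, b, hab, ha, hb⟩ := hρ w hw
      refine ⟨a, b, hab, ha.imp_right fun hx => ⟨Finset.mem_insert_of_mem hx.1, ?_⟩,
        hb.imp_right fun hx => ⟨Finset.mem_insert_of_mem hx.1, ?_⟩⟩
      all_goals
        rw [key _ hx.1, key _ hw]
        exact hx.2

/-- value of a vertex -/
def vl {n M : ℕ} (f : Fin M → Fin n → ZMod 2) : Fin n ⊕ Fin M → Fin n → ZMod 2 :=
  Sum.elim (fun i => Pi.single i 1) f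

/-- `f` solves the equations given by `l`, `r` -/
def Solves {n M : ℕ} (f : Fin M → Fin n → ZMod 2) (l r : Fin M → Fin n ⊕ Fin M) : Prop :=
  ∀ i, f i = vl f (l i) + vl f (r i)

/-- acyclicity -/
def Acyc {n M : ℕ} (l r : Fin M → Fin n ⊕ Fin M) : Prop :=
  ∃ ρ : Fin M → ℕ, ∀ i j, (l i = Sum.inr j ∨ r i = Sum.inr j) → ρ j < ρ i

theorem solves_unique {n M : ℕ} (f f' : Fin M → Fin n → ZMod 2) (l r : Fin M → Fin n ⊕ Fin M)
    (h : Solves f l r) (h' : Solves f' l r) (ha : Acyc l r) : f = f' := by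
  obtain ⟨ρ, hρ⟩ := ha
  have key : ∀ k, ∀ i, ρ i = k → f i = f' i := by
    intro k
    induction k using Nat.strong_induction_on with
    | _ k ih =>
      intro i hi
      have e : ∀ x, (l i = x ∨ r i = x) → vl f x = vl f' x := by
        rintro (x | x) hx
        · rfl
        · exact ih (ρ x) (hi ▸ hρ i x hx) x rfl
      rw [h i, h' i, e _ (Or.inl rfl), e _ (Or.inr rfl)]
  funext i
  exact key _ i rfl

theorem exists_code {n M : ℕ} (hn : 0 < n) (hM : M ≤ 2 ^ n)
    (A : Matrix (Fin n) (Fin n) (ZMod 2))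
    (hA : ∃ C : LinCircuit n, C.gates ≤ M ∧ C.Computes A) :
    ∃ (f : Fin M → Fin n → ZMod 2) (l r : Fin M → Fin n ⊕ Fin M) (o : Fin n → Fin n ⊕ Fin M),
      Function.Injective f ∧ Solves f l r ∧ Acyc l r ∧ ∀ i, vl f (o i) = A i := by
  obtain ⟨C, hC, out, hout, hval⟩ := hA
  obtain ⟨S, hS, hc, hv⟩ := rch_of_circuit C C.gates le_rfl
  obtain ⟨T, hST, hT, hTc⟩ := pad hn S hS (M - S.card) (by omega)
  replace hTc : T.card = M := by omega
  obtain ⟨ρ, hρ⟩ := rank T hT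
  let e : T ≃ Fin M := T.equivFinOfCardEq hTc
  let f : Fin M → Fin n → ZMod 2 := fun i => (e.symm i : Fin n → ZMod 2)
  have hf : ∀ x (hx : x ∈ T), f (e ⟨x, hx⟩) = x := fun x hx => by simp [f]
  have hinj : Function.Injective f := Subtype.val_injective.comp e.symm.injective
  have vert : ∀ (u : Fin n → ZMod 2) (P : Prop), (IsUnitV u ∨ (u ∈ T ∧ P)) →
      ∃ x, vl f x = u ∧ ∀ j, x = Sum.inr j → P := by
    rintro u P (⟨i, rfl⟩ | ⟨hu, hP⟩)
    · exact ⟨Sum.inl i, rfl, by simp⟩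
    · exact ⟨Sum.inr (e ⟨u, hu⟩), hf u hu, fun _ _ => hP⟩
  have step : ∀ i : Fin M, ∃ x y : Fin n ⊕ Fin M, f i = vl f x + vl f y ∧
      ∀ j, (x = Sum.inr j ∨ y = Sum.inr j) → ρ (f j) < ρ (f i) := by
    intro i
    obtain ⟨u, v, huv, hu, hv⟩ := hρ (f i) (e.symm i).2
    obtain ⟨x, hx, hx'⟩ := vert u _ hu
    obtain ⟨y, hy, hy'⟩ := vert v _ hv
    refine ⟨x, y, by rw [hx, hy, huv], ?_⟩
    rintro j (rfl | rfl)
    · have : f j = u := hx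
      rw [this]; exact hx' j rfl
    · have : f j = v := hy
      rw [this]; exact hy' j rfl
  choose l r hlr hacyc using step
  have ho : ∀ i, ∃ x, vl f x = A i := by
    intro i
    have e1 : C.val (out i) = A i := funext (hval i)
    obtain ⟨x, hx, -⟩ := vert (C.val (out i)) True
      ((hv _ (hout i)).imp_right fun h => ⟨hST h, trivial⟩)
    exact ⟨x, hx.trans e1⟩
  choose o ho using ho
  exact ⟨f, l, r, o, hinj, hlr, ⟨fun i => ρ (f i), hacyc⟩, ho⟩

/-- relabelling -/
def rl {n M : ℕ} (σ : Equiv.Perm (Fin M)) : Fin n ⊕ Fin M → Fin n ⊕ Fin M :=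
  Sum.map id σ.symm

theorem vl_rl {n M : ℕ} (σ : Equiv.Perm (Fin M)) (f : Fin M → Fin n → ZMod 2)
    (x : Fin n ⊕ Fin M) : vl (f ∘ σ) (rl σ x) = vl f x := by
  rcases x with x | x <;> simp [vl, rl]

theorem acyc_rl {n M : ℕ} (σ : Equiv.Perm (Fin M)) (l r : Fin M → Fin n ⊕ Fin M)
    (h : Acyc l r) : Acyc (fun i => rl σ (l (σ i))) (fun i => rl σ (r (σ i))) := by
  obtain ⟨ρ, hρ⟩ := h
  refine ⟨fun i => ρ (σ i), fun i j hij => hρ _ _ ?_⟩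
  have : ∀ x : Fin n ⊕ Fin M, rl σ x = Sum.inr j → x = Sum.inr (σ j) := by
    rintro (x | x) hx
    · simp [rl] at hx
    · simp only [rl, Sum.map_inr, Sum.inr.injEq] at hx
      rw [← hx]; simp
  exact hij.imp (this _) (this _)

theorem count_main {n M : ℕ} (hn : 0 < n) (hM : M ≤ 2 ^ n) :
    {A : Matrix (Fin n) (Fin n) (ZMod 2) |
        ∃ C : LinCircuit n, C.gates ≤ M ∧ C.Computes A}.ncard * M.factorial
      ≤ (n + M) ^ (2 * M) * (n + M) ^ n := by
  set X := {A : Matrix (Fin n) (Fin n) (ZMod 2) |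
        ∃ C : LinCircuit n, C.gates ≤ M ∧ C.Computes A} with hX
  have hc : ∀ A : X, _ := fun A => exists_code hn hM A.1 A.2
  choose f l r o hinj hsol hac ho using hc
  let F : X × Equiv.Perm (Fin M) → ((Fin M → Fin n ⊕ Fin M) × (Fin M → Fin n ⊕ Fin M)) ×
      (Fin n → Fin n ⊕ Fin M) := fun p =>
    ((fun i => rl p.2 (l p.1 (p.2 i)), fun i => rl p.2 (r p.1 (p.2 i))),
      fun i => rl p.2 (o p.1 i))
  have hF : Function.Injective F := by
    rintro ⟨A, σ⟩ ⟨B, τ⟩ h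
    simp only [F, Prod.mk.injEq] at h
    obtain ⟨⟨h1, h2⟩, h3⟩ := h
    have sA : Solves (f A ∘ σ) (fun i => rl σ (l A (σ i))) (fun i => rl σ (r A (σ i))) := by
      intro i
      simp only [vl_rl]
      exact hsol A (σ i)
    have sB : Solves (f B ∘ τ) (fun i => rl τ (l B (τ i))) (fun i => rl τ (r B (τ i))) := by
      intro i
      simp only [vl_rl]
      exact hsol B (τ i)
    rw [← h1, ← h2] at sB
    have hff := solves_unique _ _ _ _ sA sB (acyc_rl σ _ _ (hac A))
    have hAB : A = B := by
      apply Subtype.ext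
      funext i
      have := congrFun h3 i
      rw [← ho A i, ← ho B i, ← vl_rl σ (f A), hff, this, vl_rl]
    subst hAB
    have : σ = τ := Equiv.ext fun i => hinj A (congrFun hff i)
    rw [this]
  have := Nat.card_le_card_of_injective F hF
  simp only [Nat.card_prod, Nat.card_coe_set_eq] at this
  simp only [Nat.card_eq_fintype_card, Fintype.card_perm, Fintype.card_fun, Fintype.card_sum,
    Fintype.card_fin] at this
  calc _ ≤ _ := this
    _ = _ := by ring

theorem count_triv {n M : ℕ} (hM : 2 ^ n < M) :
    {A : Matrix (Fin n) (Fin n) (ZMod 2) |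
        ∃ C : LinCircuit n, C.gates ≤ M ∧ C.Computes A}.ncard * M.factorial
      ≤ (n + M) ^ (2 * M) * (n + M) ^ n := by
  have h1 : {A : Matrix (Fin n) (Fin n) (ZMod 2) |
        ∃ C : LinCircuit n, C.gates ≤ M ∧ C.Computes A}.ncard ≤ 2 ^ (n * n) := by
    refine (Set.ncard_le_card _).trans ?_
    have : Nat.card (Matrix (Fin n) (Fin n) (ZMod 2)) = 2 ^ (n * n) := by
      simp [Matrix, Nat.card_eq_fintype_card, ZMod.card, pow_mul]
    exact this.le
  have hn : n < 2 ^ n := Nat.lt_two_pow_self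
  have h2 : 2 ^ (n * n) ≤ (n + M) ^ M := by
    rw [pow_mul]
    calc (2 ^ n) ^ n ≤ (n + M) ^ n := Nat.pow_le_pow_left (by omega) _
      _ ≤ (n + M) ^ M := Nat.pow_le_pow_right (by omega) (by omega)
  have h3 : M.factorial ≤ (n + M) ^ M :=
    (Nat.factorial_le_pow M).trans (Nat.pow_le_pow_left (by omega) _)
  calc _ ≤ (n + M) ^ M * (n + M) ^ M := Nat.mul_le_mul (h1.trans h2) h3
    _ = (n + M) ^ (2 * M) * 1 := by ring
    _ ≤ _ := Nat.mul_le_mul_left _ (Nat.one_le_pow _ _ (by omega))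

end CountAux

open Nat in
/-- For all positive integers `n` and `M`, the number of
distinct `n × n` matrices over `F_2` computable by a linear circuit with at
most `M` gates is at most `(n+M)^{2M} · (n+M+1)^n / M!`. -/
theorem count_computable_matrices_le (n M : ℕ) (hn : 0 < n) (hM : 0 < M) :
    (({A : Matrix (Fin n) (Fin n) (ZMod 2) |
        ∃ C : LinCircuit n, C.gates ≤ M ∧ C.Computes A}.ncard : ℝ))
      ≤ (n + M : ℝ) ^ (2 * M) * (n + M + 1 : ℝ) ^ n / (M ! : ℝ) := by
  rw [le_div_iff₀ (by exact_mod_cast Nat.factorial_pos M)]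
  have h := (Nat.lt_or_ge (2 ^ n) M).elim CountAux.count_triv (CountAux.count_main hn)
  have h' := h.trans (Nat.mul_le_mul_left _ (Nat.pow_le_pow_left (Nat.le_succ (n + M)) n))
  exact_mod_cast h'
end

section
/- For every ε with 0 < ε < 1, the fraction of n×n matrices over F_2 that are computable by a linear circuit (cancellation allowed) with at most (1−ε)·n²/(4 log₂ n) gates tends to 0 as n → ∞; equivalently, almost every n×n matrix over F_2 requires at least n²/(4 log₂ n) − o(n²/log₂ n) gates in any linear circuit computing it. -/
theorem LinCircuit.ext_aux {n : ℕ} (C D : LinCircuit n) (hg : C.gates = D.gates)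
    (hl : ∀ i (h1 : i < C.gates) (h2 : i < D.gates), C.left ⟨i, h1⟩ = D.left ⟨i, h2⟩)
    (hr : ∀ i (h1 : i < C.gates) (h2 : i < D.gates), C.right ⟨i, h1⟩ = D.right ⟨i, h2⟩) :
    C = D := by
  cases C with
  | mk g l r a b =>
  cases D with
  | mk g' l' r' a' b' =>
  dsimp only at hg hl hr
  subst hg
  have h1 : l = l' := by
    funext i
    exact hl i.1 i.2 i.2
  have h2 : r = r' := by
    funext i
    exact hr i.1 i.2 i.2
  subst h1
  subst h2
  rfl

theorem count_aux (n S : ℕ) (P : LinCircuit n → Prop) (hP : ∀ C, P C → C.gates ≤ S) :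
    {A : Matrix (Fin n) (Fin n) (ZMod 2) | ∃ C : LinCircuit n, P C ∧ C.Computes A}.ncard
      ≤ (S + 1) * (n + S + 1) ^ (2 * S + n) := by
  classical
  set s := {A : Matrix (Fin n) (Fin n) (ZMod 2) | ∃ C : LinCircuit n, P C ∧ C.Computes A} with hs
  have key : ∀ A : s, ∃ C : LinCircuit n, C.gates ≤ S ∧ ∃ out : Fin n → ℕ,
      (∀ o, out o < n + C.gates) ∧ ∀ o j, C.val (out o) j = A.1 o j := by
    rintro ⟨A, C, hC, out, h⟩
    exact ⟨C, hP C hC, out, h⟩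
  choose C hC out hout hval using key
  let f : s → Fin (S + 1) × (Fin S → Fin (n + S + 1)) × (Fin S → Fin (n + S + 1)) ×
      (Fin n → Fin (n + S + 1)) := fun A =>
    (⟨(C A).gates, Nat.lt_succ_of_le (hC A)⟩,
     fun i => if h : i.1 < (C A).gates then
        ⟨(C A).left ⟨i.1, h⟩, by have := (C A).left_lt ⟨i.1, h⟩; dsimp only at this; omega⟩ else 0,
     fun i => if h : i.1 < (C A).gates then
        ⟨(C A).right ⟨i.1, h⟩, by have := (C A).right_lt ⟨i.1, h⟩; dsimp only at this; omega⟩ else 0,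
     fun o => ⟨out A o, by have := hout A o; have := hC A; omega⟩)
  have hf : Function.Injective f := by
    intro A B h
    simp only [f, Prod.mk.injEq, Fin.mk.injEq] at h
    obtain ⟨h1, h2, h3, h4⟩ := h
    have hCD : C A = C B := by
      apply LinCircuit.ext_aux _ _ h1
      · intro i a b
        have := congrFun h2 ⟨i, lt_of_lt_of_le a (hC A)⟩
        simpa [a, b] using this
      · intro i a b
        have := congrFun h3 ⟨i, lt_of_lt_of_le a (hC A)⟩
        simpa [a, b] using this
    apply Subtype.ext
    funext o j
    have h5 := congrFun h4 o
    simp only [Fin.mk.injEq] at h5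
    rw [← hval A, ← hval B, hCD, h5]
  have := Nat.card_le_card_of_injective f hf
  rw [Nat.card_coe_set_eq] at this
  refine this.trans (le_of_eq ?_)
  simp only [Nat.card_eq_fintype_card, Fintype.card_prod, Fintype.card_fin, Fintype.card_fun]
  ring

theorem bound_aux (ε : ℝ) (hε0 : 0 < ε) (hε1 : ε < 1) (n : ℕ) (hn : 4 ≤ n) :
    (({A : Matrix (Fin n) (Fin n) (ZMod 2) |
          ∃ C : LinCircuit n,
            (C.gates : ℝ) ≤ (1 - ε) * (n : ℝ) ^ 2 / (4 * Real.logb 2 n) ∧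
              C.Computes A}.ncard : ℝ) / 2 ^ (n ^ 2)) ≤
      (2 : ℝ) ^ (2 * (n + 1) * Real.logb 2 n - ε * n ^ 2) := by
  have hn' : (4 : ℝ) ≤ n := by exact_mod_cast hn
  have hL : 2 ≤ Real.logb 2 n := by
    rw [Real.le_logb_iff_rpow_le (by norm_num) (by linarith)]
    norm_num
    linarith
  set L := Real.logb 2 n with hLdef
  set X := (1 - ε) * (n : ℝ) ^ 2 / (4 * L) with hX
  have hX0 : 0 ≤ X := by
    have : 0 ≤ 1 - ε := by linarith
    positivity
  have hXL : X * (4 * L) = (1 - ε) * (n : ℝ) ^ 2 := by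
    rw [hX]; field_simp
  set S := ⌊X⌋₊ with hS
  have hSX : (S : ℝ) ≤ X := Nat.floor_le hX0
  have h8 : X * 8 ≤ (n : ℝ) ^ 2 := by nlinarith
  have hc := count_aux n S (fun C => (C.gates : ℝ) ≤ X) (fun C h => Nat.le_floor h)
  have hN : ((n + S + 1 : ℕ) : ℝ) ≤ (n : ℝ) ^ 2 := by push_cast; nlinarith
  have hS1 : ((S + 1 : ℕ) : ℝ) ≤ (n : ℝ) ^ 2 := by push_cast; nlinarith
  have hc' : (({A : Matrix (Fin n) (Fin n) (ZMod 2) |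
          ∃ C : LinCircuit n, (C.gates : ℝ) ≤ X ∧ C.Computes A}.ncard : ℕ) : ℝ)
      ≤ ((n : ℝ) ^ 2) ^ (2 * S + n + 1) := by
    calc _ ≤ (((S + 1) * (n + S + 1) ^ (2 * S + n) : ℕ) : ℝ) := by exact_mod_cast hc
      _ = ((S + 1 : ℕ) : ℝ) * ((n + S + 1 : ℕ) : ℝ) ^ (2 * S + n) := by push_cast; ring
      _ ≤ (n : ℝ) ^ 2 * ((n : ℝ) ^ 2) ^ (2 * S + n) := by gcongr
      _ = _ := by ring
  have h2 : (n : ℝ) = (2 : ℝ) ^ L := by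
    rw [hLdef, Real.rpow_logb] <;> first | linarith | norm_num
  have h3 : ((n : ℝ) ^ 2) ^ (2 * S + n + 1) = (2 : ℝ) ^ (L * (2 * (2 * S + n + 1))) := by
    rw [← pow_mul]
    conv_lhs => rw [h2]
    rw [← Real.rpow_natCast, ← Real.rpow_mul (by norm_num)]
    push_cast
    rfl
  have h4 : (2 : ℝ) ^ (n ^ 2) = (2 : ℝ) ^ ((n : ℝ) ^ 2) := by
    rw [← Real.rpow_natCast]; push_cast; rfl
  rw [div_le_iff₀ (by positivity), h4, ← Real.rpow_add (by norm_num)]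
  refine hc'.trans ?_
  rw [h3]
  apply Real.rpow_le_rpow_of_exponent_le (by norm_num)
  nlinarith

/-- For every `ε` with `0 < ε < 1`, the fraction of `n × n`
matrices over `F_2` computable by a linear circuit (cancellation allowed) with
at most `(1 − ε) · n² / (4 log₂ n)` gates tends to `0` as `n → ∞` (that is,
almost every `n × n` matrix requires at least `n²/(4 log₂ n) − o(n²/log₂ n)`
gates). -/
theorem almost_all_matrices_hard (ε : ℝ) (hε0 : 0 < ε) (hε1 : ε < 1) :
    Filter.Tendsto (fun n : ℕ =>
      ({A : Matrix (Fin n) (Fin n) (ZMod 2) |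
          ∃ C : LinCircuit n,
            (C.gates : ℝ) ≤ (1 - ε) * (n : ℝ) ^ 2 / (4 * Real.logb 2 n) ∧
              C.Computes A}.ncard : ℝ) / 2 ^ (n ^ 2))
      Filter.atTop (nhds 0) := by
  have hlim : Filter.Tendsto (fun n : ℕ => ((1 / 2 : ℝ)) ^ n) Filter.atTop (nhds 0) :=
    tendsto_pow_atTop_nhds_zero_of_lt_one (by norm_num) (by norm_num)
  refine squeeze_zero' (Filter.Eventually.of_forall fun n => by positivity) ?_ hlim
  have hlog : ∀ᶠ n : ℕ in Filter.atTop, Real.logb 2 n ≤ ε / 8 * n := by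
    have h1 := (Real.isLittleO_log_id_atTop.comp_tendsto
      (tendsto_natCast_atTop_atTop (R := ℝ))).def
      (show 0 < ε / 8 * Real.log 2 by have := Real.log_pos (by norm_num : (1:ℝ) < 2); positivity)
    filter_upwards [h1] with n hn
    have h2 := Real.log_pos (by norm_num : (1:ℝ) < 2)
    simp only [Function.comp, id, Real.norm_eq_abs, Nat.abs_cast] at hn
    rw [Real.logb, div_le_iff₀ h2]
    have := le_abs_self (Real.log n)
    linarith
  filter_upwards [hlog, Filter.eventually_ge_atTop 4,
    Filter.eventually_ge_atTop ⌈2 / ε⌉₊] with n h1 h2 h3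
  refine (bound_aux ε hε0 hε1 n h2).trans ?_
  have h4 : 2 / ε ≤ n := Nat.ceil_le.mp h3
  rw [div_le_iff₀ hε0] at h4
  have h5 : (4 : ℝ) ≤ n := by exact_mod_cast h2
  have h6 : (1 / 2 : ℝ) ^ n = (2 : ℝ) ^ (-(n : ℝ)) := by
    rw [Real.rpow_neg (by norm_num), Real.rpow_natCast]; simp
  rw [h6]
  apply Real.rpow_le_rpow_of_exponent_le (by norm_num)
  have h7 : 2 * ((n : ℝ) + 1) * Real.logb 2 n ≤ 4 * n * (ε / 8 * n) := by
    apply (mul_le_mul_of_nonneg_left h1 (by positivity)).trans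
    exact mul_le_mul_of_nonneg_right (by linarith) (by positivity)
  nlinarith
end

section
/- For every k ≥ 1, with n = 2^k, the n×n Sierpinski gasket matrix S_k can be computed by a cancellation-free linear circuit with exactly (1/2)·n·log₂ n = k·2^{k−1} gates. -/
/-- The Sierpinski gasket matrix `S_k`, defined recursively by `S_0 = (1)` and
`S_{k+1} = [[S_k, 0], [S_k, S_k]]` as a block matrix. -/
def sierpinski : (k : ℕ) → Matrix (Fin (2 ^ k)) (Fin (2 ^ k)) (ZMod 2)
  | 0 => Matrix.of fun _ _ => 1
  | (k + 1) => Matrix.of fun i j =>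
      have he : 2 ^ (k + 1) = 2 ^ k + 2 ^ k := by rw [pow_succ]; ring
      have hi2 : (i : ℕ) < 2 ^ k + 2 ^ k := by have := i.isLt; omega
      have hj2 : (j : ℕ) < 2 ^ k + 2 ^ k := by have := j.isLt; omega
      if hi : (i : ℕ) < 2 ^ k then
        if hj : (j : ℕ) < 2 ^ k then sierpinski k ⟨i, hi⟩ ⟨j, hj⟩ else 0
      else
        if hj : (j : ℕ) < 2 ^ k then sierpinski k ⟨(i : ℕ) - 2 ^ k, by omega⟩ ⟨j, hj⟩
        else sierpinski k ⟨(i : ℕ) - 2 ^ k, by omega⟩ ⟨(j : ℕ) - 2 ^ k, by omega⟩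


namespace SG

open Classical in
/-- reachable set of vectors with `N` gates -/
def R (n N : ℕ) (V : Set (Fin n → ZMod 2)) : Prop :=
  ∃ C : LinCircuit n, C.CancellationFree ∧ C.gates = N ∧
    ∀ v ∈ V, ∃ w, w < n + C.gates ∧ C.val w = v

lemma cf_of_edge {n : ℕ} (C : LinCircuit n)
    (h : ∀ w u, C.Edge w u → ∀ i, C.val w i = 1 → C.val u i = 1) : C.CancellationFree := by
  intro w u hwu
  induction hwu with
  | single e => exact h _ _ e
  | tail _ e ih => exact fun i hi => h _ _ e i (ih i hi)

lemma R_mono {n N : ℕ} {V W : Set (Fin n → ZMod 2)} (h : R n N V) (hW : W ⊆ V) : R n N W := by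
  obtain ⟨C, h1, h2, h3⟩ := h
  exact ⟨C, h1, h2, fun v hv => h3 v (hW hv)⟩

/-- append a gate -/
def app {n : ℕ} (C : LinCircuit n) (a b : ℕ) (ha : a < n + C.gates) (hb : b < n + C.gates) :
    LinCircuit n where
  gates := C.gates + 1
  left g := if h : g.val < C.gates then C.left ⟨g.val, h⟩ else a
  right g := if h : g.val < C.gates then C.right ⟨g.val, h⟩ else b
  left_lt g := by
    split
    · exact C.left_lt _
    · omega
  right_lt g := by
    split
    · exact C.right_lt _
    · omega

lemma app_val {n : ℕ} (C : LinCircuit n) (a b : ℕ) (ha : a < n + C.gates) (hb : b < n + C.gates)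
    (v : ℕ) : v < n + C.gates → (app C a b ha hb).val v = C.val v := by
  induction v using Nat.strong_induction_on with
  | _ v ih =>
    intro hv
    rw [LinCircuit.val, LinCircuit.val]
    by_cases h1 : v < n
    · simp [h1]
    · have h2 : v - n < C.gates := by omega
      have h3 : v - n < (app C a b ha hb).gates := by simp only [app]; omega
      have hl := C.left_lt ⟨v - n, h2⟩
      have hr := C.right_lt ⟨v - n, h2⟩
      simp only at hl hr
      have e1 : (app C a b ha hb).left ⟨v - n, h3⟩ = C.left ⟨v - n, h2⟩ := by simp [app, h2]
      have e2 : (app C a b ha hb).right ⟨v - n, h3⟩ = C.right ⟨v - n, h2⟩ := by simp [app, h2]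
      rw [dif_neg h1, dif_neg h1, dif_pos h2, dif_pos h3, e1, e2,
        ih _ (by omega) (by omega), ih _ (by omega) (by omega)]

lemma app_val_new {n : ℕ} (C : LinCircuit n) (a b : ℕ) (ha : a < n + C.gates)
    (hb : b < n + C.gates) :
    (app C a b ha hb).val (n + C.gates) = C.val a + C.val b := by
  rw [LinCircuit.val]
  have h3 : n + C.gates - n < (app C a b ha hb).gates := by simp only [app]; omega
  have e1 : (app C a b ha hb).left ⟨n + C.gates - n, h3⟩ = a := by simp [app]
  have e2 : (app C a b ha hb).right ⟨n + C.gates - n, h3⟩ = b := by simp [app]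
  rw [dif_neg (by omega), dif_pos h3, e1, e2, app_val _ _ _ _ _ _ ha, app_val _ _ _ _ _ _ hb]

lemma R_insert {n N : ℕ} {V : Set (Fin n → ZMod 2)} (h : R n N V) {a b : Fin n → ZMod 2}
    (ha : a ∈ V) (hb : b ∈ V) (hab : ∀ i, a i = 0 ∨ b i = 0) : R n (N + 1) (insert (a + b) V) := by
  obtain ⟨C, h1, h2, h3⟩ := h
  obtain ⟨x, hx, rfl⟩ := h3 _ ha
  obtain ⟨y, hy, rfl⟩ := h3 _ hb
  refine ⟨app C x y hx hy, ?_, by simp [app, h2], ?_⟩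
  · apply cf_of_edge
    rintro w u ⟨g, rfl, hg⟩ i
    by_cases hgl : g.val < C.gates
    · have hE : C.Edge w (n + g.val) := by
        refine ⟨⟨g.val, hgl⟩, rfl, ?_⟩
        simpa [app, hgl] using hg
      have hw : w < n + g.val := by
        rcases hg with rfl | rfl
        · exact LinCircuit.left_lt _ g
        · exact LinCircuit.right_lt _ g
      rw [app_val _ _ _ _ _ _ (by omega), app_val _ _ _ _ _ _ (by omega)]
      exact h1 _ _ (.single hE) i
    · have hgg : g.val = C.gates := by
        have : g.val < C.gates + 1 := g.isLt
        omega
      rw [hgg, app_val_new]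
      simp only [app, hgl, dif_neg, not_false_iff] at hg
      have := hab i
      rcases hg with rfl | rfl
      · rw [app_val _ _ _ _ _ _ hx]
        intro hi
        rcases this with h | h
        · simp [h] at hi
        · simp [h, hi]
      · rw [app_val _ _ _ _ _ _ hy]
        intro hi
        rcases this with h | h
        · simp [h, hi]
        · simp [h] at hi
  · rintro v (rfl | hv)
    · exact ⟨n + C.gates, by simp [app], app_val_new _ _ _ _ _⟩
    · obtain ⟨w, hw, rfl⟩ := h3 v hv
      exact ⟨w, by simp only [app]; omega, app_val _ _ _ _ _ _ hw⟩

lemma R_union {n N : ℕ} {V : Set (Fin n → ZMod 2)} (h : R n N V) (s : Finset ℕ)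
    (f g : ℕ → Fin n → ZMod 2) (hf : ∀ x ∈ s, f x ∈ V) (hg : ∀ x ∈ s, g x ∈ V)
    (hfg : ∀ x ∈ s, ∀ i, f x i = 0 ∨ g x i = 0) :
    R n (N + s.card) (V ∪ (fun x => f x + g x) '' s) := by
  induction s using Finset.induction_on with
  | empty => simpa using h
  | insert a s ha ih =>
    have ih' := ih (fun x hx => hf x (Finset.mem_insert_of_mem hx))
      (fun x hx => hg x (Finset.mem_insert_of_mem hx))
      (fun x hx => hfg x (Finset.mem_insert_of_mem hx))
    have hm := Finset.mem_insert_self a s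
    have := R_insert ih' (Or.inl (hf a hm)) (Or.inl (hg a hm)) (hfg a hm)
    rw [Finset.card_insert_of_notMem ha]
    refine R_mono this ?_
    rintro v (hv | ⟨x, hx, rfl⟩)
    · exact Or.inr (Or.inl hv)
    · rcases Finset.mem_insert.1 (Finset.mem_coe.1 hx) with rfl | hx
      · exact Or.inl rfl
      · exact Or.inr (Or.inr ⟨x, hx, rfl⟩)

/-- support relation after `t` stages -/
def P (t i j : ℕ) : Prop :=
  (∀ b, t ≤ b → i.testBit b = j.testBit b) ∧ ∀ b, b < t → j.testBit b = true → i.testBit b = true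

open Classical in
/-- row `i` after `t` stages -/
noncomputable def M (n t i : ℕ) : Fin n → ZMod 2 := fun j => if P t i j then 1 else 0

lemma testBit_flip (i t b : ℕ) :
    (i ^^^ 2 ^ t).testBit b = (if b = t then !i.testBit b else i.testBit b) := by
  rw [Nat.testBit_xor, Nat.testBit_two_pow]
  by_cases h : b = t
  · simp [h]
  · simp [h, Ne.symm h]

lemma P_succ_false {t i j : ℕ} (h : i.testBit t = false) : P (t + 1) i j ↔ P t i j := by
  constructor
  · rintro ⟨h1, h2⟩
    refine ⟨fun b hb => ?_, fun b hb => h2 b (by omega)⟩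
    rcases Nat.eq_or_lt_of_le hb with rfl | hb
    · have := h2 t (by omega)
      rw [h] at this ⊢
      cases hj : j.testBit t <;> simp_all
    · exact h1 b hb
  · rintro ⟨h1, h2⟩
    refine ⟨fun b hb => h1 b (by omega), fun b hb hj => ?_⟩
    rcases Nat.eq_or_lt_of_le (Nat.le_of_lt_succ hb) with rfl | hb
    · rw [h1 b le_rfl, hj]
    · exact h2 b hb hj

lemma P_flip {t i j : ℕ} : P t (i ^^^ 2 ^ t) j ↔
    (∀ b, t + 1 ≤ b → i.testBit b = j.testBit b) ∧ (i.testBit t = !j.testBit t) ∧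
      ∀ b, b < t → j.testBit b = true → i.testBit b = true := by
  unfold P
  simp only [testBit_flip]
  constructor
  · rintro ⟨h1, h2⟩
    refine ⟨fun b hb => ?_, ?_, fun b hb => ?_⟩
    · simpa [show b ≠ t by omega] using h1 b (by omega)
    · have := h1 t le_rfl
      simp at this
      simp [← this]
    · simpa [show b ≠ t by omega] using h2 b hb
  · rintro ⟨h1, h2, h3⟩
    refine ⟨fun b hb => ?_, fun b hb => ?_⟩
    · by_cases hbt : b = t
      · subst hbt; simp [h2]
      · simpa [hbt] using h1 b (by omega)
    · simpa [show b ≠ t by omega] using h3 b hb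

lemma P_iff {t i j : ℕ} : P t i j ↔
    (∀ b, t + 1 ≤ b → i.testBit b = j.testBit b) ∧ (i.testBit t = j.testBit t) ∧
      ∀ b, b < t → j.testBit b = true → i.testBit b = true := by
  constructor
  · rintro ⟨h1, h2⟩
    exact ⟨fun b hb => h1 b (by omega), h1 t le_rfl, h2⟩
  · rintro ⟨h1, h2, h3⟩
    refine ⟨fun b hb => ?_, h3⟩
    rcases Nat.eq_or_lt_of_le hb with rfl | hb
    · exact h2
    · exact h1 b hb

lemma P_disj {t i j : ℕ} : ¬ (P t i j ∧ P t (i ^^^ 2 ^ t) j) := by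
  rw [P_flip, P_iff]
  rintro ⟨⟨-, h, -⟩, -, h', -⟩
  rw [h] at h'
  revert h'
  cases j.testBit t <;> simp

lemma P_succ_true {t i j : ℕ} (h : i.testBit t = true) :
    P (t + 1) i j ↔ P t i j ∨ P t (i ^^^ 2 ^ t) j := by
  rw [P_flip, P_iff (t := t)]
  have : P (t + 1) i j ↔ (∀ b, t + 1 ≤ b → i.testBit b = j.testBit b) ∧
      ∀ b, b < t → j.testBit b = true → i.testBit b = true := by
    constructor
    · rintro ⟨h1, h2⟩
      exact ⟨h1, fun b hb => h2 b (by omega)⟩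
    · rintro ⟨h1, h2⟩
      refine ⟨h1, fun b hb hj => ?_⟩
      rcases Nat.eq_or_lt_of_le (Nat.le_of_lt_succ hb) with rfl | hb
      · exact h
      · exact h2 b hb hj
  rw [this, h]
  cases hj : j.testBit t <;> simp

lemma M_disj (n t i : ℕ) (j : Fin n) : M n t i j = 0 ∨ M n t (i ^^^ 2 ^ t) j = 0 := by
  have := P_disj (t := t) (i := i) (j := j)
  unfold M
  by_cases h : P t i j
  · right; rw [if_neg (fun h' => this ⟨h, h'⟩)]
  · left; rw [if_neg h]

lemma M_succ (n t i : ℕ) : M n (t + 1) i =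
    if i.testBit t = true then M n t i + M n t (i ^^^ 2 ^ t) else M n t i := by
  split_ifs with h
  · ext j
    have h1 := P_disj (t := t) (i := i) (j := j)
    have h2 := P_succ_true (j := j) h
    simp only [M, Pi.add_apply, h2]
    by_cases ha : P t i j <;> by_cases hb : P t (i ^^^ 2 ^ t) j <;> simp_all
  · ext j
    have h0 : i.testBit t = false := by simpa using h
    classical
    exact if_congr (P_succ_false h0) rfl rfl

lemma card_bits (k t : ℕ) (ht : t < k) :
    ((Finset.range (2 ^ k)).filter (fun i => i.testBit t = true)).card = 2 ^ (k - 1) := by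
  have h1 := Finset.card_filter_add_card_filter_not (s := Finset.range (2 ^ k))
    (fun i : ℕ => i.testBit t = true)
  have hlt : ∀ i, i < 2 ^ k → i ^^^ 2 ^ t < 2 ^ k := fun i hi =>
    Nat.xor_lt_two_pow hi (Nat.pow_lt_pow_right (by norm_num) ht)
  have h2 : ((Finset.range (2 ^ k)).filter (fun i => i.testBit t = true)).card =
      ((Finset.range (2 ^ k)).filter (fun i => ¬ i.testBit t = true)).card := by
    apply Finset.card_nbij' (fun i => i ^^^ 2 ^ t) (fun i => i ^^^ 2 ^ t)
    · intro i hi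
      simp only [Finset.coe_filter, Finset.mem_range, Set.mem_ofPred_eq] at hi ⊢
      exact ⟨hlt i hi.1, by simp [testBit_flip, hi.2]⟩
    · intro i hi
      simp only [Finset.coe_filter, Finset.mem_range, Set.mem_ofPred_eq] at hi ⊢
      exact ⟨hlt i hi.1, by simp [testBit_flip, hi.2]⟩
    · intro i _; simp [Nat.xor_assoc]
    · intro i _; simp [Nat.xor_assoc]
  rw [← h2, Finset.card_range] at h1
  obtain ⟨k, rfl⟩ : ∃ m, k = m + 1 := ⟨k - 1, by omega⟩
  have h3 : 2 ^ (k + 1) = 2 ^ k * 2 := pow_succ 2 k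
  simp only [Nat.add_sub_cancel]
  omega

lemma main (k t : ℕ) (ht : t ≤ k) :
    R (2 ^ k) (t * 2 ^ (k - 1)) ((fun i => M (2 ^ k) t i) '' {i | i < 2 ^ k}) := by
  induction t with
  | zero =>
    refine ⟨⟨0, fun _ => 0, fun _ => 0, fun g => g.elim0, fun g => g.elim0⟩, ?_, by simp, ?_⟩
    · apply cf_of_edge
      rintro w u ⟨g, -⟩
      exact g.elim0
    · rintro v ⟨i, hi, rfl⟩
      refine ⟨i, by simpa using hi, ?_⟩
      rw [LinCircuit.val, dif_pos (show i < 2 ^ k from hi)]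
      ext j
      have : P 0 i j ↔ (j : ℕ) = i := by
        constructor
        · intro h
          exact (Nat.eq_of_testBit_eq (fun b => h.1 b (Nat.zero_le _))).symm
        · intro h
          exact ⟨fun b _ => by rw [h], fun b hb => by omega⟩
      classical
      exact if_congr this.symm rfl rfl
  | succ t ih =>
    have := R_union (ih (by omega)) ((Finset.range (2 ^ k)).filter (fun i => i.testBit t = true))
      (fun i => M (2 ^ k) t i) (fun i => M (2 ^ k) t (i ^^^ 2 ^ t))
      (fun x hx => ⟨x, by simpa using (Finset.mem_filter.1 hx).1, rfl⟩)
      (fun x hx => ⟨x ^^^ 2 ^ t, Nat.xor_lt_two_pow (by simpa using (Finset.mem_filter.1 hx).1)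
        (Nat.pow_lt_pow_right (by norm_num) ht), rfl⟩)
      (fun x _ j => M_disj _ _ _ _)
    rw [card_bits k t ht, ← Nat.succ_mul] at this
    refine R_mono this ?_
    rintro v ⟨i, hi, rfl⟩
    simp only [M_succ]
    split_ifs with h
    · exact Or.inr ⟨i, by simpa [h] using hi, rfl⟩
    · exact Or.inl ⟨i, hi, rfl⟩

/-- subset relation on bits -/
def Sub (j i : ℕ) : Prop := ∀ b, j.testBit b = true → i.testBit b = true

lemma testBit_add (k i b : ℕ) (hi : i < 2 ^ k) :
    (2 ^ k + i).testBit b = (decide (k = b) || i.testBit b) := by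
  have h := Nat.two_pow_add_eq_or_of_lt hi 1
  rw [mul_one] at h
  rw [h, Nat.testBit_or, Nat.testBit_two_pow]

lemma testBit_high (k i : ℕ) (hi : i < 2 ^ k) : i.testBit k = false :=
  Nat.testBit_lt_two_pow hi

lemma sub_hl (k i j : ℕ) (hi : i < 2 ^ k) : ¬ Sub (2 ^ k + j) i ∨ 2 ^ k ≤ j := by
  by_cases hj : j < 2 ^ k
  · left
    intro h
    have := h k (by simp [testBit_add k j k hj])
    simp [testBit_high k i hi] at this
  · right; omega

lemma sub_lh (k i j : ℕ) (hi : i < 2 ^ k) (hj : j < 2 ^ k) : Sub j (2 ^ k + i) ↔ Sub j i := by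
  have := testBit_high k j hj
  refine forall_congr' fun b => ?_
  rw [testBit_add k i b hi]
  by_cases h : k = b
  · subst h; simp [this]
  · simp [h]

lemma sub_hh (k i j : ℕ) (hi : i < 2 ^ k) (hj : j < 2 ^ k) :
    Sub (2 ^ k + j) (2 ^ k + i) ↔ Sub j i := by
  have := testBit_high k j hj
  refine forall_congr' fun b => ?_
  rw [testBit_add k i b hi, testBit_add k j b hj]
  by_cases h : k = b
  · subst h; simp [this]
  · simp [h]

open Classical in
lemma sierp_eq (k : ℕ) (i j : Fin (2 ^ k)) :
    sierpinski k i j = if Sub j i then 1 else 0 := by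
  induction k with
  | zero =>
    have : Sub j i := by
      have hi := i.isLt
      have hj := j.isLt
      have : (i : ℕ) = j := by simp at hi hj; omega
      intro b; rw [this]; exact id
    rw [if_pos this]
    simp [sierpinski]
  | succ k ih =>
    obtain ⟨i, hi'⟩ := i
    obtain ⟨j, hj'⟩ := j
    have he : 2 ^ (k + 1) = 2 ^ k + 2 ^ k := by rw [pow_succ]; ring
    simp only [sierpinski, Matrix.of_apply, ih]
    by_cases hi : i < 2 ^ k
    · by_cases hj : j < 2 ^ k
      · simp [hi, hj]
      · obtain ⟨j, rfl⟩ := Nat.exists_eq_add_of_le (not_lt.1 hj)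
        have := (sub_hl k i j hi).resolve_right (by omega)
        simp [hi, this]
    · obtain ⟨i, rfl⟩ := Nat.exists_eq_add_of_le (not_lt.1 hi)
      by_cases hj : j < 2 ^ k
      · have := sub_lh k i j (by omega) hj
        simp [hj, this]
      · obtain ⟨j, rfl⟩ := Nat.exists_eq_add_of_le (not_lt.1 hj)
        have := sub_hh k i j (by omega) (by omega)
        simp [this]

lemma P_eq_sub (k i j : ℕ) (hi : i < 2 ^ k) (hj : j < 2 ^ k) : P k i j ↔ Sub j i := by
  have hh : ∀ x, x < 2 ^ k → ∀ b, k ≤ b → x.testBit b = false := fun x hx b hb =>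
    Nat.testBit_lt_two_pow (hx.trans_le (Nat.pow_le_pow_right (by norm_num) hb))
  constructor
  · rintro ⟨h1, h2⟩ b hb
    rcases lt_or_ge b k with h | h
    · exact h2 b h hb
    · rw [h1 b h, hb]
  · intro h
    exact ⟨fun b hb => by rw [hh i hi b hb, hh j hj b hb], fun b _ => h b⟩

end SG

/-- For every `k ≥ 1`, with `n = 2^k`, the `n × n`
Sierpinski gasket matrix `S_k` can be computed by a cancellation-free linear
circuit with exactly `(1/2) · n · log₂ n = k · 2^(k−1)` gates. -/
theorem sierpinski_cancellationFree_upper_bound (k : ℕ) (hk : 1 ≤ k) :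
    ∃ C : LinCircuit (2 ^ k), C.CancellationFree ∧ C.Computes (sierpinski k) ∧
      C.gates = k * 2 ^ (k - 1) := by
  obtain ⟨C, h1, h2, h3⟩ := SG.main k k le_rfl
  have h4 : ∀ o : Fin (2 ^ k), ∃ w, w < 2 ^ k + C.gates ∧ C.val w = SG.M (2 ^ k) k o :=
    fun o => h3 _ ⟨o, o.isLt, rfl⟩
  choose out ho hv using h4
  refine ⟨C, h1, ⟨out, ho, fun o j => ?_⟩, h2⟩
  rw [hv, SG.sierp_eq]
  classical
  exact if_congr (SG.P_eq_sub k o j o.isLt j.isLt) rfl rfl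
end

section
/- Let h, k ≥ 1 be integers and let M be an n×n matrix over F_2 such that there do not exist a set R of h+1 rows and a set S of k+1 columns with M_{ij} = 1 for all i ∈ R and j ∈ S (i.e., the bipartite graph with adjacency matrix M contains no K_{h+1,k+1}). Then every cancellation-free linear circuit computing M has size at least (1/h)·Σ_{i=1}^{n}(|M_i|/k − 1), where |M_i| denotes the number of ones in row i of M; in particular, for fixed h and k the cancellation-free circuit size of M is Ω(|M|), where |M| is the total number of ones in M. -/
namespace LinCircuit

open Classical in
/-- support of a vertex -/
noncomputable def supp {n : ℕ} (C : LinCircuit n) (v : ℕ) : Finset (Fin n) :=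
  Finset.univ.filter fun j => C.val v j = 1

lemma mem_supp {n : ℕ} (C : LinCircuit n) (v : ℕ) (j : Fin n) :
    j ∈ C.supp v ↔ C.val v j = 1 := by simp [supp]

lemma supp_input {n : ℕ} (C : LinCircuit n) (v : ℕ) (hv : v < n) : (C.supp v).card ≤ 1 := by
  rw [Finset.card_le_one]
  intro a ha b hb
  rw [mem_supp, val, dif_pos hv] at ha hb
  have h1 : (a : ℕ) = v := by by_contra hne; simp [hne] at ha
  have h2 : (b : ℕ) = v := by by_contra hne; simp [hne] at hb
  exact Fin.ext (h1.trans h2.symm)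

lemma supp_out {n : ℕ} (C : LinCircuit n) (v : ℕ) (hv : n + C.gates ≤ v) :
    (C.supp v).card = 0 := by
  rw [Finset.card_eq_zero, Finset.eq_empty_iff_forall_notMem]
  intro a ha
  rw [mem_supp, val, dif_neg (by omega), dif_neg (by omega)] at ha
  simp at ha

lemma supp_gate {n : ℕ} (C : LinCircuit n) (g : Fin C.gates) :
    C.supp (n + g.val) ⊆ C.supp (C.left g) ∪ C.supp (C.right g) := by
  intro a ha
  rw [mem_supp, val, dif_neg (by omega), dif_pos (by simp)] at ha
  rw [Finset.mem_union, mem_supp, mem_supp]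
  have key : ∀ x y : ZMod 2, x + y = 1 → x = 1 ∨ y = 1 := by decide
  have e : (⟨n + g.val - n, by simp⟩ : Fin C.gates) = g := by ext; simp
  rw [e] at ha
  exact key _ _ ha

open Classical in
lemma cover {n : ℕ} (C : LinCircuit n) (k : ℕ) (hk : 1 ≤ k) (P : ℕ → Prop)
    (hP : ∀ w u, C.Edge w u → P u → P w) (N : ℕ) :
    ∀ B : Finset ℕ, (∀ b ∈ B, b < N ∧ P b) →
      (B.biUnion C.supp).card ≤
        k * (B.card + ((Finset.range N).filter fun v => P v ∧ k < (C.supp v).card).card) := by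
  induction N with
  | zero =>
    intro B hB
    have : B = ∅ := Finset.eq_empty_of_forall_notMem fun b hb => by
      have := (hB b hb).1; omega
    subst this; simp
  | succ N ih =>
    intro B hB
    by_cases hN : N ∈ B
    · have hsplit : B.biUnion C.supp = C.supp N ∪ (B.erase N).biUnion C.supp := by
        rw [← Finset.biUnion_insert, Finset.insert_erase hN]
      have hcard : (B.erase N).card + 1 = B.card := Finset.card_erase_add_one hN
      have herase : ∀ b ∈ B.erase N, b < N ∧ P b := by
        intro b hb
        rw [Finset.mem_erase] at hb
        have := hB b hb.2
        exact ⟨by omega, this.2⟩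
      by_cases hheavy : k < (C.supp N).card
      · have h1 : n ≤ N := by
          by_contra hc
          have := C.supp_input N (by omega); omega
        have h2 : N < n + C.gates := by
          by_contra hc
          have := C.supp_out N (by omega); omega
        obtain ⟨g, hg⟩ : ∃ g : Fin C.gates, N = n + g.val :=
          ⟨⟨N - n, by omega⟩, by simp only; omega⟩
        have hPN := (hB N hN).2
        have hl := C.left_lt g
        have hr := C.right_lt g
        have := ih (insert (C.left g) (insert (C.right g) (B.erase N))) (by
          intro b hb
          rw [Finset.mem_insert, Finset.mem_insert] at hb
          rcases hb with rfl | rfl | hb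
          · exact ⟨by omega, hP _ _ ⟨g, hg, Or.inl rfl⟩ hPN⟩
          · exact ⟨by omega, hP _ _ ⟨g, hg, Or.inr rfl⟩ hPN⟩
          · exact herase b hb)
        have hsub : B.biUnion C.supp ⊆
            (insert (C.left g) (insert (C.right g) (B.erase N))).biUnion C.supp := by
          rw [hsplit, Finset.biUnion_insert, Finset.biUnion_insert, ← Finset.union_assoc]
          apply Finset.union_subset_union_left
          rw [hg]; exact C.supp_gate g
        refine (Finset.card_le_card hsub).trans (this.trans ?_)
        apply Nat.mul_le_mul_left
        rw [Finset.range_add_one, Finset.filter_insert, if_pos ⟨hPN, hheavy⟩]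
        have a0 := Finset.card_insert_of_notMem (a := N)
          (s := (Finset.range N).filter fun v => P v ∧ k < (C.supp v).card) (by simp)
        have a1 := Finset.card_insert_le (C.left g) (insert (C.right g) (B.erase N))
        have a2 := Finset.card_insert_le (C.right g) (B.erase N)
        omega
      · have := ih _ herase
        rw [hsplit]
        refine (Finset.card_union_le _ _).trans ?_
        rw [Finset.range_add_one, Finset.filter_insert, if_neg (fun hc => hheavy hc.2), ← hcard]
        push Not at hheavy
        nlinarith
    · have := ih B (fun b hb => by
        have h1 := hB b hb
        have h2 : b ≠ N := fun hc => hN (hc ▸ hb)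
        exact ⟨by omega, h1.2⟩)
      refine this.trans ?_
      apply Nat.mul_le_mul_left
      gcongr
      omega

end LinCircuit

/-- Let `h, k ≥ 1` and let `M` be an `n × n` matrix over
`F_2` such that there do not exist `h + 1` rows and `k + 1` columns all of
whose common entries are `1` (no `K_{h+1,k+1}` in the associated bipartite
graph).  Then every cancellation-free linear circuit computing `M` has size at
least `(1/h) · Σ_i (|M_i|/k − 1)`, where `|M_i|` is the number of ones in row
`i` of `M`. -/
theorem mehlhorn_lower_bound (h k n : ℕ) (hh : 1 ≤ h) (hk : 1 ≤ k)
    (M : Matrix (Fin n) (Fin n) (ZMod 2))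
    (hfree : ¬ ∃ (R S : Finset (Fin n)), R.card = h + 1 ∧ S.card = k + 1 ∧
      ∀ i ∈ R, ∀ j ∈ S, M i j = 1)
    (C : LinCircuit n) (hcf : C.CancellationFree) (hM : C.Computes M) :
    (1 / (h : ℝ)) *
        ∑ i : Fin n,
          (((Finset.univ.filter fun j : Fin n => M i j = 1).card : ℝ) / (k : ℝ) - 1)
      ≤ (C.gates : ℝ) := by
  classical
  obtain ⟨out, hout, hval⟩ := hM
  let P : Fin n → ℕ → Prop := fun i v => Relation.ReflTransGen C.Edge v (out i)
  let r : Fin n → ℕ → Prop := fun i v => P i v ∧ k < (C.supp v).card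
  let V := Finset.range (n + C.gates)
  have hrow : ∀ i : Fin n, (Finset.univ.filter fun j : Fin n => M i j = 1) = C.supp (out i) := by
    intro i; ext j; simp [LinCircuit.mem_supp, hval]
  have h1 : ∀ i : Fin n, (C.supp (out i)).card ≤ k * (1 + (V.filter (r i)).card) := by
    intro i
    have := C.cover k hk (P i) (fun w u e hu => Relation.ReflTransGen.head e hu) (n + C.gates)
      {out i} (by
        intro b hb
        rw [Finset.mem_singleton] at hb
        subst hb
        exact ⟨hout i, Relation.ReflTransGen.refl⟩)
    simpa using this
  have hmono : ∀ i v, P i v → ∀ j, C.val v j = 1 → M i j = 1 := by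
    intro i v hp j hj
    rw [← hval]
    rcases Relation.reflTransGen_iff_eq_or_transGen.mp hp with he | ht
    · rw [he]; exact hj
    · exact hcf _ _ ht j hj
  have h2 : ∀ v ∈ V, (Finset.univ.filter fun i => r i v).card ≤ if n ≤ v then h else 0 := by
    intro v hv
    by_cases hheavy : k < (C.supp v).card
    · have hn : n ≤ v := by
        by_contra hc
        have := C.supp_input v (by omega); omega
      rw [if_pos hn]
      by_contra hc
      push Not at hc
      obtain ⟨R, hR, hRc⟩ := Finset.exists_subset_card_eq (Nat.succ_le_of_lt hc)
      obtain ⟨S, hS, hSc⟩ := Finset.exists_subset_card_eq (Nat.succ_le_of_lt hheavy)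
      refine hfree ⟨R, S, hRc, hSc, fun i hi j hj => ?_⟩
      have hi' := (Finset.mem_filter.mp (hR hi)).2
      exact hmono i v hi'.1 j ((C.mem_supp v j).mp (hS hj))
    · have : (Finset.univ.filter fun i => r i v) = ∅ := by
        apply Finset.filter_eq_empty_iff.mpr
        intro i _ hc
        exact hheavy hc.2
      rw [this]; simp
  have h3 : ∑ i : Fin n, (V.filter (r i)).card ≤ h * C.gates := by
    have e : ∑ i : Fin n, (V.filter (r i)).card
        = ∑ v ∈ V, (Finset.univ.filter fun i => r i v).card :=
      Finset.sum_card_bipartiteAbove_eq_sum_card_bipartiteBelow r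
    rw [e]
    refine (Finset.sum_le_sum h2).trans ?_
    simp only [V]
    rw [Finset.sum_range_add]
    rw [Finset.sum_eq_zero (fun x hx => if_neg (by rw [Finset.mem_range] at hx; omega))]
    simp [mul_comm]
  have hk0 : (0 : ℝ) < k := by exact_mod_cast hk
  have hh0 : (0 : ℝ) < h := by exact_mod_cast hh
  have h4 : ∑ i : Fin n,
      (((Finset.univ.filter fun j : Fin n => M i j = 1).card : ℝ) / (k : ℝ) - 1)
      ≤ ∑ i : Fin n, ((V.filter (r i)).card : ℝ) := by
    apply Finset.sum_le_sum
    intro i _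
    rw [hrow, sub_le_iff_le_add, div_le_iff₀ hk0]
    have : ((C.supp (out i)).card : ℝ) ≤ k * (1 + (V.filter (r i)).card) := by
      exact_mod_cast h1 i
    linarith
  have h5 : ∑ i : Fin n, ((V.filter (r i)).card : ℝ) ≤ h * C.gates := by exact_mod_cast h3
  rw [one_div, inv_mul_le_iff₀ hh0]
  exact h4.trans h5
end

section
/- For every ε with 0 < ε < 1 and for all sufficiently large M with M ≥ n, one has (n+M)^{2M} · (n+M+1)^n / M! ≤ 2^{2M log₂ M + O(M)}; consequently, taking M = (1−ε)·n²/(4 log₂ n), the number of n×n matrices over F_2 computable by a linear circuit with at most M gates is at most 2^{(1−ε)n² + o(n²)}. -/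
namespace LinCircuit

/-- Pad a circuit to `M` gates. -/
def pad {n : ℕ} (hn : 0 < n) (C : LinCircuit n) (M : ℕ) : LinCircuit n where
  gates := M
  left g := if h : g.val < C.gates then C.left ⟨g.val, h⟩ else 0
  right g := if h : g.val < C.gates then C.right ⟨g.val, h⟩ else 0
  left_lt g := by
    split_ifs with h
    · exact C.left_lt ⟨g.val, h⟩
    · omega
  right_lt g := by
    split_ifs with h
    · exact C.right_lt ⟨g.val, h⟩
    · omega

theorem pad_val {n : ℕ} (hn : 0 < n) (C : LinCircuit n) (M : ℕ) (hM : C.gates ≤ M) (v : ℕ)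
    (hv : v < n + C.gates) : (C.pad hn M).val v = C.val v := by
  induction v using Nat.strong_induction_on with
  | _ v ih =>
    rw [val, val.eq_def C]
    by_cases h1 : v < n
    · simp [h1]
    · have h2 : v - n < C.gates := by omega
      have h3 : v - n < (C.pad hn M).gates := by
        show v - n < M
        omega
      have hl : (C.pad hn M).left ⟨v - n, h3⟩ = C.left ⟨v - n, h2⟩ := by
        simp [pad, h2]
      have hr : (C.pad hn M).right ⟨v - n, h3⟩ = C.right ⟨v - n, h2⟩ := by
        simp [pad, h2]
      have a1 := C.left_lt ⟨v - n, h2⟩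
      have a2 := C.right_lt ⟨v - n, h2⟩
      simp only at a1 a2
      rw [dif_neg h1, dif_neg h1, dif_pos h2, dif_pos h3, hl, hr,
        ih _ (by omega) (by omega), ih _ (by omega) (by omega)]

/-- Circuit from a raw description. -/
def ofRaw {n : ℕ} (hn : 0 < n) (M : ℕ) (p : Fin M → Fin (n + M) × Fin (n + M)) :
    LinCircuit n where
  gates := M
  left g := if (p g).1.val < n + g.val then (p g).1.val else 0
  right g := if (p g).2.val < n + g.val then (p g).2.val else 0
  left_lt g := by split_ifs <;> omega
  right_lt g := by split_ifs <;> omega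

theorem exists_ofRaw {n : ℕ} (hn : 0 < n) (C : LinCircuit n) :
    ∃ p, ofRaw hn C.gates p = C := by
  refine ⟨fun g => (⟨C.left g, by have := C.left_lt g; omega⟩,
    ⟨C.right g, by have := C.right_lt g; omega⟩), ?_⟩
  cases C with
  | mk G l r hl hr => simp [ofRaw, hl, hr]

theorem ncard_le {n : ℕ} (hn : 0 < n) (M : ℕ) :
    {A : Matrix (Fin n) (Fin n) (ZMod 2) | ∃ C : LinCircuit n, C.gates ≤ M ∧ C.Computes A}.ncard
      ≤ (n + M) ^ (2 * M + n) := by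
  let F : (Fin M → Fin (n + M) × Fin (n + M)) × (Fin n → Fin (n + M)) →
      Matrix (Fin n) (Fin n) (ZMod 2) := fun q o j => (ofRaw hn M q.1).val (q.2 o).val j
  have hsub : {A : Matrix (Fin n) (Fin n) (ZMod 2) |
      ∃ C : LinCircuit n, C.gates ≤ M ∧ C.Computes A} ⊆ F '' Set.univ := by
    rintro A ⟨C, hC, out, ho, hA⟩
    obtain ⟨p, hp⟩ := exists_ofRaw hn (C.pad hn M)
    refine ⟨(p, fun o => ⟨out o, by have := ho o; omega⟩), trivial, ?_⟩
    funext o j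
    have hp' : ofRaw hn M p = C.pad hn M := hp
    show (ofRaw hn M p).val (out o) j = A o j
    rw [hp', pad_val hn C M hC _ (ho o), hA]
  refine (Set.ncard_le_ncard hsub (Set.toFinite _)).trans ((Set.ncard_image_le).trans ?_)
  rw [Set.ncard_univ, Nat.card_eq_fintype_card]
  simp only [Fintype.card_prod, Fintype.card_fun, Fintype.card_fin]
  rw [pow_add, pow_mul, pow_two]

end LinCircuit

theorem counting_part1 (n M : ℕ) (hM : 1 ≤ M) (hn : n ≤ M) :
      (n + M : ℝ) ^ (2 * M) * (n + M + 1 : ℝ) ^ n / (Nat.factorial M : ℝ)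
        ≤ 2 ^ (2 * (M : ℝ) * Real.logb 2 M + 6 * M) := by
  have hM' : (1 : ℝ) ≤ M := by exact_mod_cast hM
  have hn' : (n : ℝ) ≤ M := by exact_mod_cast hn
  have hn0 : (0 : ℝ) ≤ n := by positivity
  have e1 : (2 : ℝ) ^ (2 * (M : ℝ) * Real.logb 2 M + 6 * M) = (M : ℝ) ^ (2 * M) * 64 ^ M := by
    rw [Real.rpow_add (by norm_num)]
    congr 1
    · rw [mul_comm, Real.rpow_mul (by norm_num), Real.rpow_logb (by norm_num) (by norm_num)
        (by linarith)]
      exact_mod_cast Real.rpow_natCast (M : ℝ) (2 * M)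
    · rw [Real.rpow_mul (by norm_num), Real.rpow_natCast]
      norm_num
  have h1 : (n + M : ℝ) ^ (2 * M) ≤ (2 * M) ^ (2 * M) :=
    pow_le_pow_left₀ (by positivity) (by linarith) _
  have h2 : (n + M + 1 : ℝ) ^ n ≤ (3 * M) ^ M :=
    (pow_le_pow_left₀ (by positivity) (by linarith) _).trans
      (pow_le_pow_right₀ (by linarith) hn)
  have h3 : (M : ℝ) ^ M ≤ 3 ^ M * (Nat.factorial M : ℝ) := by
    have h := Real.pow_div_factorial_le_exp (M : ℝ) (by positivity) M
    rw [div_le_iff₀ (by positivity)] at h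
    refine h.trans ?_
    gcongr
    rw [← mul_one (M : ℝ), Real.exp_nat_mul]
    exact pow_le_pow_left₀ (by positivity) (by linarith [Real.exp_one_lt_d9]) _
  rw [e1, div_le_iff₀ (by positivity)]
  calc (n + M : ℝ) ^ (2 * M) * (n + M + 1 : ℝ) ^ n
      ≤ (2 * M) ^ (2 * M) * (3 * M) ^ M := by gcongr
    _ = (M : ℝ) ^ (2 * M) * 12 ^ M * (M : ℝ) ^ M := by
      rw [mul_pow, mul_pow, pow_mul (2 : ℝ), show (12 : ℝ) = 2 ^ 2 * 3 by norm_num,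
        mul_pow ((2 : ℝ) ^ 2)]
      ring
    _ ≤ (M : ℝ) ^ (2 * M) * 12 ^ M * (3 ^ M * (Nat.factorial M : ℝ)) := by gcongr
    _ = (M : ℝ) ^ (2 * M) * 36 ^ M * (Nat.factorial M : ℝ) := by
      rw [show (36 : ℝ) = 12 * 3 by norm_num, mul_pow (12 : ℝ)]
      ring
    _ ≤ (M : ℝ) ^ (2 * M) * 64 ^ M * (Nat.factorial M : ℝ) := by
      gcongr
      norm_num

theorem counting_littleo :
    (fun n : ℕ => 2 * (n : ℝ) * Real.logb 2 n) =o[Filter.atTop] fun n : ℕ => (n : ℝ) ^ 2 := by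
  have h : (fun n : ℕ => Real.log (n : ℝ)) =o[Filter.atTop] fun n : ℕ => (n : ℝ) :=
    Real.isLittleO_log_id_atTop.comp_tendsto tendsto_natCast_atTop_atTop
  have h2 := ((Asymptotics.isBigO_refl (fun n : ℕ => (n : ℝ)) Filter.atTop).mul_isLittleO
    h).const_mul_left (2 / Real.log 2)
  refine (h2.congr ?_ ?_)
  · intro n
    simp only [Real.logb]
    ring
  · intro n
    ring

theorem counting_part2 (ε : ℝ) (h0 : 0 < ε) (hε : ε < 1) (n : ℕ) (hn : 2 ≤ n) :
    ({A : Matrix (Fin n) (Fin n) (ZMod 2) |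
              ∃ C : LinCircuit n,
                (C.gates : ℝ) ≤ (1 - ε) * (n : ℝ) ^ 2 / (4 * Real.logb 2 n) ∧
                  C.Computes A}.ncard : ℝ)
            ≤ 2 ^ ((1 - ε) * (n : ℝ) ^ 2 + 2 * (n : ℝ) * Real.logb 2 n) := by
  have hn' : (2 : ℝ) ≤ n := by exact_mod_cast hn
  set L := Real.logb 2 n with hL
  have hL1 : 1 ≤ L := by
    rw [hL, Real.le_logb_iff_rpow_le (by norm_num) (by linarith)]
    simpa using hn'
  set x := (1 - ε) * (n : ℝ) ^ 2 / (4 * L) with hx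
  have hx0 : 0 ≤ x := by
    have : 0 ≤ 1 - ε := by linarith
    positivity
  have hxL : 4 * x * L = (1 - ε) * (n : ℝ) ^ 2 := by
    rw [hx]; field_simp
  set M := ⌊x⌋₊ with hMdef
  have hMx : (M : ℝ) ≤ x := Nat.floor_le hx0
  have hset : {A : Matrix (Fin n) (Fin n) (ZMod 2) |
      ∃ C : LinCircuit n, (C.gates : ℝ) ≤ x ∧ C.Computes A} =
      {A | ∃ C : LinCircuit n, C.gates ≤ M ∧ C.Computes A} := by
    ext A
    simp only [Set.mem_setOf_eq, hMdef, Nat.le_floor_iff hx0]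
  rw [hset]
  have hc := LinCircuit.ncard_le (n := n) (by omega) M
  have hc' : (({A | ∃ C : LinCircuit n, C.gates ≤ M ∧ C.Computes A} :
      Set (Matrix (Fin n) (Fin n) (ZMod 2))).ncard : ℝ) ≤ (n + M : ℝ) ^ (2 * M + n) := by
    exact_mod_cast hc
  have hM4 : 4 * (M : ℝ) ≤ (n : ℝ) ^ 2 := by
    have : 4 * x ≤ 4 * x * L := le_mul_of_one_le_right (by positivity) hL1
    nlinarith [sq_nonneg (n : ℝ)]
  have hN : (n + M : ℝ) ≤ (n : ℝ) ^ 2 := by nlinarith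
  have hn2 : (n : ℝ) = 2 ^ L := by
    rw [hL, Real.rpow_logb (by norm_num) (by norm_num) (by linarith)]
  calc _ ≤ (n + M : ℝ) ^ (2 * M + n) := hc'
    _ ≤ ((n : ℝ) ^ 2) ^ (2 * M + n) := pow_le_pow_left₀ (by positivity) hN _
    _ = ((2 : ℝ) ^ L) ^ (2 * (2 * M + n)) := by rw [← hn2, pow_mul]
    _ = (2 : ℝ) ^ (4 * M * L + 2 * n * L) := by
      rw [← Real.rpow_natCast, ← Real.rpow_mul (by norm_num)]
      congr 1
      push_cast
      ring
    _ ≤ _ := by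
      apply Real.rpow_le_rpow_of_exponent_le (by norm_num)
      rw [← hxL]
      gcongr

open Asymptotics in
/-- For all sufficiently large `M` with `M ≥ n` one has
`(n+M)^{2M} · (n+M+1)^n / M! ≤ 2^{2M log₂ M + O(M)}`; consequently, for every
`0 < ε < 1`, taking `M = (1−ε) · n² / (4 log₂ n)`, the number of `n × n`
matrices over `F_2` computable by a linear circuit with at most `M` gates is
at most `2^{(1−ε)n² + o(n²)}`. -/
theorem counting_bound :
    (∃ c : ℝ, 0 < c ∧ ∃ M₀ : ℕ, ∀ n M : ℕ, M₀ ≤ M → n ≤ M →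
      (n + M : ℝ) ^ (2 * M) * (n + M + 1 : ℝ) ^ n / (Nat.factorial M : ℝ)
        ≤ 2 ^ (2 * (M : ℝ) * Real.logb 2 M + c * M)) ∧
    (∀ ε : ℝ, 0 < ε → ε < 1 →
      ∃ f : ℕ → ℝ, (f =o[Filter.atTop] fun n : ℕ => (n : ℝ) ^ 2) ∧
        ∀ n : ℕ, 2 ≤ n →
          ({A : Matrix (Fin n) (Fin n) (ZMod 2) |
              ∃ C : LinCircuit n,
                (C.gates : ℝ) ≤ (1 - ε) * (n : ℝ) ^ 2 / (4 * Real.logb 2 n) ∧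
                  C.Computes A}.ncard : ℝ)
            ≤ 2 ^ ((1 - ε) * (n : ℝ) ^ 2 + f n)) := by
  refine ⟨⟨6, by norm_num, 1, fun n M hM hn => counting_part1 n M hM hn⟩, fun ε h0 h1 =>
    ⟨fun n : ℕ => 2 * (n : ℝ) * Real.logb 2 n, counting_littleo,
      fun n hn => counting_part2 ε h0 h1 n hn⟩⟩
end
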